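/- arXiv:2410.04394 — 4 statements merged into one kernel-verified Lean document; each statement's English description precedes it below -/
import Mathlib

section
/- Let q ≥ 2, C ≥ 1, let d ≥ 3 be an integer, let α, ε ∈ (0,1], let L ≥ 1, let p > 1, and set Π := 2^113 · q^10 · C^2 · d^24 · L^8 / (α^14 · ε^18). Let G be a d-regular simple graph on [n] that satisfies the long-range expansion property Expan(α,ε,L), let k ≥ 1, and let ‖·‖_X be a 1-unconditional norm on ℝ^k that has cotype q with constant C. If f : [n] → ℝ^k is any non-constant map with min{|{v ∈ [n] : f(v)_j ≥ 0}|, |{v ∈ [n] : f(v)_j ≤ 0}|} ≥ n/2 for every j ∈ [k], then ∑_{v∈[n]} ‖f(v)‖_X^p ≤ (3Π/2)^p · d^{p−1} · (max{2,p})^p · ∑_{{w,w'}∈E_G} ‖f(w)−f(w')‖_X^p. -/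
open Finset

attribute [local instance] Classical.propDecidable

noncomputable section

/-- Distance (in `ℕ∞`) from a vertex to a finite set of vertices. -/
def vertexSetDist {n : ℕ} (G : SimpleGraph (Fin n)) (v : Fin n) (S : Finset (Fin n)) : ℕ∞ :=
  S.inf fun w => G.edist v w

/-- Distance (in `ℕ∞`) from a vertex to an (unordered) edge. -/
def edgeDist {n : ℕ} (G : SimpleGraph (Fin n)) (v : Fin n) (e : Sym2 (Fin n)) : ℕ∞ :=
  Sym2.lift ⟨fun a b => min (G.edist v a) (G.edist v b), fun _ _ => min_comm _ _⟩ e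

/-- Distance (in `ℕ∞`) from an (unordered) edge to a finite set of vertices. -/
def edgeSetDist {n : ℕ} (G : SimpleGraph (Fin n)) (e : Sym2 (Fin n)) (S : Finset (Fin n)) : ℕ∞ :=
  S.inf fun v => edgeDist G v e

/-- Part (A) of the long-range expansion property. -/
def ExpanA (n d : ℕ) (G : SimpleGraph (Fin n)) (α : ℝ) : Prop :=
  ∀ S : Finset (Fin n), S.Nonempty → ∀ ℓ : ℕ, 1 ≤ ℓ →
    min (3 * (n : ℝ) / 4) (α * ((d : ℝ) - 1) ^ ℓ * S.card) ≤
      ((univ.filter fun v => vertexSetDist G v S ≤ (ℓ : ℕ∞)).card : ℝ)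

/-- Part (B) of the long-range expansion property. -/
def ExpanB (n d : ℕ) (G : SimpleGraph (Fin n)) [DecidableRel G.Adj] (α ε L : ℝ) : Prop :=
  ∀ S : Finset (Fin n), S.Nonempty → ∀ ℓ : ℕ, 1 ≤ ℓ →
    α * ((d : ℝ) - 1) ^ (ℓ - 1) * S.card ≤ 3 * n / 4 →
    ∃ v ∈ S,
      (((G.edgeFinset.filter fun e =>
            L * ((d : ℝ) - 1 - ε) ^ ℓ ≤
              ((S.filter fun u => edgeDist G u e ≤ ((ℓ - 1 : ℕ) : ℕ∞)).card : ℝ)).filter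
          fun e => edgeDist G v e ≤ ((ℓ - 1 : ℕ) : ℕ∞)).card : ℝ) ≤
        L * ((d : ℝ) - 1 - ε) ^ ℓ

/-- The long-range expansion property `Expan(α, ε, L)`. -/
def Expan (n d : ℕ) (G : SimpleGraph (Fin n)) [DecidableRel G.Adj] (α ε L : ℝ) : Prop :=
  ExpanA n d G α ∧ ExpanB n d G α ε L

/-- `N` is a norm on `ℝ^k`. -/
def IsNorm (k : ℕ) (N : (Fin k → ℝ) → ℝ) : Prop :=
  (∀ x, N x = 0 ↔ x = 0) ∧ (∀ (c : ℝ) (x), N (c • x) = |c| * N x) ∧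
    ∀ x y, N (x + y) ≤ N x + N y

/-- The standard basis of `ℝ^k` is `K`-unconditional for `N`. -/
def UncondConst (k : ℕ) (N : (Fin k → ℝ) → ℝ) (K : ℝ) : Prop :=
  ∀ (σ : Fin k → Bool) (a : Fin k → ℝ),
    N (fun j => (if σ j then (1 : ℝ) else -1) * a j) ≤ K * N a

/-- `N` is a `1`-unconditional norm on `ℝ^k`: `‖y‖ = ‖|y|‖`. -/
def OneUnconditional (k : ℕ) (N : (Fin k → ℝ) → ℝ) : Prop :=
  ∀ y, N y = N fun j => |y j|

/-- `N` has cotype `q` with constant `C`. -/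
def HasCotype (k : ℕ) (N : (Fin k → ℝ) → ℝ) (q C : ℝ) : Prop :=
  ∀ (m : ℕ) (x : Fin m → Fin k → ℝ),
    1 / C ^ q * ∑ i, N (x i) ^ q ≤
      1 / 2 ^ m * ∑ σ : Fin m → Bool, N (∑ i, (if σ i then (1 : ℝ) else -1) • x i) ^ q

/-- The collection of vectors `Y` has restricted cotype `q` with constant `C` w.r.t. `N`. -/
def RestrictedCotype (k : ℕ) (N : (Fin k → ℝ) → ℝ) (q C : ℝ) (Y : Set (Fin k → ℝ)) : Prop :=
  ∀ (m : ℕ), 0 < m → ∀ y : Fin m → Fin k → ℝ, Function.Injective y → (∀ i, y i ∈ Y) →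
    1 / C ^ q * ∑ i, N (y i) ^ q ≤
      1 / 2 ^ m * ∑ σ : Fin m → Bool, N (∑ i, (if σ i then (1 : ℝ) else -1) • y i) ^ q

/-- For an edge `e = {a, b}`, the value `N (f a - f b)` (well-defined when `N` is a norm). -/
def edgeNorm {n k : ℕ} (N : (Fin k → ℝ) → ℝ) (f : Fin n → Fin k → ℝ) (e : Sym2 (Fin n)) : ℝ :=
  Sym2.lift ⟨fun a b => min (N (f a - f b)) (N (f b - f a)), fun _ _ => min_comm _ _⟩ e

/-- Coordinate projection `P_J`. -/
def proj {k : ℕ} (J : Finset (Fin k)) (y : Fin k → ℝ) : Fin k → ℝ :=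
  fun j => if j ∈ J then y j else 0

/-- Indicator vector `χ_J ∈ ℝ^k`. -/
def chi {k : ℕ} (J : Finset (Fin k)) : Fin k → ℝ := fun j => if j ∈ J then 1 else 0

/-- The sequence `a_ℓ = (6/π²) ℓ⁻²`. -/
def aseq (ℓ : ℕ) : ℝ := 6 / Real.pi ^ 2 * (1 / (ℓ : ℝ) ^ 2)

/-- The set of edges `E(S, j; ℓ)`: edges within distance `ℓ - 1` of `S` with a jump in the
`j`-th coordinate. -/
def jumpEdges {n k : ℕ} (G : SimpleGraph (Fin n)) [DecidableRel G.Adj]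
    (f : Fin n → Fin k → ℝ) (j : Fin k) (S : Finset (Fin n)) (ℓ : ℕ) :
    Finset (Sym2 (Fin n)) :=
  G.edgeFinset.filter fun e =>
    edgeSetDist G e S ≤ ((ℓ - 1 : ℕ) : ℕ∞) ∧
      Sym2.lift ⟨fun a b => f a j ≠ f b j, fun _ _ => propext ne_comm⟩ e

/-- The scale `ℓ_{v,j}`. -/
def lvj {n k : ℕ} (G : SimpleGraph (Fin n)) [DecidableRel G.Adj]
    (f : Fin n → Fin k → ℝ) (α : ℝ) (d : ℕ) (v : Fin n) (j : Fin k) : ℕ :=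
  sInf {ℓ : ℕ | 1 ≤ ℓ ∧
    α * aseq ℓ / 6 * ((d : ℝ) - 1) ^ (ℓ - 1) ≤ ((jumpEdges G f j {v} ℓ).card : ℝ)}

/-- The set `V_+(j; ℓ)`. -/
def Vplus {n k : ℕ} (G : SimpleGraph (Fin n)) [DecidableRel G.Adj]
    (f : Fin n → Fin k → ℝ) (α : ℝ) (d : ℕ) (j : Fin k) (ℓ : ℕ) : Finset (Fin n) :=
  univ.filter fun v => f v j = 1 ∧ lvj G f α d v j = ℓ

/-- The set `V_-(j; ℓ)`. -/
def Vminus {n k : ℕ} (G : SimpleGraph (Fin n)) [DecidableRel G.Adj]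
    (f : Fin n → Fin k → ℝ) (α : ℝ) (d : ℕ) (j : Fin k) (ℓ : ℕ) : Finset (Fin n) :=
  univ.filter fun v => f v j = -1 ∧ lvj G f α d v j = ℓ

/-- The scale-`ℓ` support `J(v, ℓ)`. -/
def Jset {n k : ℕ} (G : SimpleGraph (Fin n)) [DecidableRel G.Adj]
    (f : Fin n → Fin k → ℝ) (α : ℝ) (d : ℕ) (v : Fin n) (ℓ : ℕ) : Finset (Fin k) :=
  univ.filter fun j => f v j ≠ 0 ∧ lvj G f α d v j = ℓ

/-- The scale-`ℓ` mutual support `J(v, ℓ, e)`, relative to a family `Ẽ(v, j)` of edge sets. -/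
def JsetE {n k : ℕ} (G : SimpleGraph (Fin n)) [DecidableRel G.Adj]
    (f : Fin n → Fin k → ℝ) (α : ℝ) (d : ℕ) (Et : Fin n → Fin k → Finset (Sym2 (Fin n)))
    (v : Fin n) (ℓ : ℕ) (e : Sym2 (Fin n)) : Finset (Fin k) :=
  (Jset G f α d v ℓ).filter fun j => e ∈ Et v j

end
namespace Pf

lemma edist_le_iff {n : ℕ} (G : SimpleGraph (Fin n)) (v u : Fin n) (r : ℕ) :
    G.edist v u ≤ (r : ℕ∞) ↔ ∃ w : G.Walk v u, w.length ≤ r := by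
  constructor
  · intro h
    have h1 : G.edist v u ≠ ⊤ := ne_top_of_le_ne_top (ENat.natCast_ne_top r) h
    obtain ⟨w, hw⟩ := SimpleGraph.exists_walk_of_edist_ne_top h1
    refine ⟨w, ?_⟩
    rw [← hw] at h
    exact_mod_cast h
  · rintro ⟨w, hw⟩
    exact (SimpleGraph.edist_le w).trans (by exact_mod_cast hw)

lemma pred_exists {n : ℕ} (G : SimpleGraph (Fin n)) (v u : Fin n) (r : ℕ)
    (h : G.edist v u = ((r + 1 : ℕ) : ℕ∞)) : ∃ x, G.Adj x u ∧ G.edist v x = (r : ℕ∞) := by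
  rw [SimpleGraph.edist_comm] at h
  have h1 : G.edist u v ≠ ⊤ := by rw [h]; exact ENat.natCast_ne_top _
  obtain ⟨w, hw⟩ := SimpleGraph.exists_walk_of_edist_ne_top h1
  rw [h] at hw
  have hw' : w.length = r + 1 := by exact_mod_cast hw
  cases w with
  | nil => simp at hw'
  | @cons _ x _ hadj p =>
    refine ⟨x, hadj.symm, ?_⟩
    rw [SimpleGraph.edist_comm]
    have hp : p.length = r := by simpa using hw'
    apply le_antisymm
    · exact (edist_le_iff G x v r).2 ⟨p, hp.le⟩
    · by_contra hlt
      push Not at hlt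
      have : G.edist x v ≠ ⊤ := ne_top_of_lt hlt
      obtain ⟨w2, hw2⟩ := SimpleGraph.exists_walk_of_edist_ne_top this
      rw [← hw2] at hlt
      have h3 : w2.length < r := by exact_mod_cast hlt
      have h4 := SimpleGraph.edist_le (SimpleGraph.Walk.cons hadj w2)
      rw [h] at h4
      have h5 : r + 1 ≤ (SimpleGraph.Walk.cons hadj w2).length := by exact_mod_cast h4
      simp at h5
      omega

lemma sphere_card {n d : ℕ} (G : SimpleGraph (Fin n)) [DecidableRel G.Adj]
    (hreg : ∀ v, G.degree v = d) (v : Fin n) (r : ℕ) :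
    (univ.filter fun u => G.edist v u = ((r + 1 : ℕ) : ℕ∞)).card ≤ d * (d - 1) ^ r := by
  induction r with
  | zero =>
    have : (univ.filter fun u => G.edist v u = ((0 + 1 : ℕ) : ℕ∞)) ⊆ G.neighborFinset v := by
      intro u hu
      simp only [mem_filter, mem_univ, true_and] at hu
      obtain ⟨x, hx, hx0⟩ := pred_exists G v u 0 hu
      have : v = x := by simpa using hx0
      subst this
      simpa using hx
    have h := card_le_card this
    simpa [hreg v] using h
  | succ r ih =>
    set S := univ.filter fun u => G.edist v u = ((r + 1 : ℕ) : ℕ∞) with hS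
    have hsub : (univ.filter fun u => G.edist v u = ((r + 1 + 1 : ℕ) : ℕ∞)) ⊆
        S.biUnion fun x => (G.neighborFinset x).filter fun u => G.edist v u = ((r + 1 + 1 : ℕ) : ℕ∞) := by
      intro u hu
      simp only [mem_filter, mem_univ, true_and] at hu
      obtain ⟨x, hx, hx0⟩ := pred_exists G v u (r + 1) hu
      simp only [mem_biUnion, hS, mem_filter, mem_univ, true_and, SimpleGraph.mem_neighborFinset]
      exact ⟨x, hx0, hx, hu⟩
    have hb : ∀ x ∈ S, ((G.neighborFinset x).filter fun u => G.edist v u = ((r + 1 + 1 : ℕ) : ℕ∞)).card ≤ d - 1 := by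
      intro x hx
      simp only [hS, mem_filter, mem_univ, true_and] at hx
      obtain ⟨y, hy, hy0⟩ := pred_exists G v x r hx
      have hy1 : y ∈ G.neighborFinset x := by simpa using hy.symm
      have : ((G.neighborFinset x).filter fun u => G.edist v u = ((r + 1 + 1 : ℕ) : ℕ∞)) ⊆ (G.neighborFinset x).erase y := by
        intro u hu
        simp only [mem_filter] at hu
        refine mem_erase.2 ⟨?_, hu.1⟩
        rintro rfl
        have := hu.2
        rw [hy0] at this
        have : r = r + 1 + 1 := by exact_mod_cast this
        omega
      refine (card_le_card this).trans ?_
      rw [card_erase_of_mem hy1, SimpleGraph.card_neighborFinset_eq_degree, hreg]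
    calc _ ≤ _ := card_le_card hsub
      _ ≤ S.card * (d - 1) := card_biUnion_le_card_mul _ _ _ hb
      _ ≤ d * (d - 1) ^ r * (d - 1) := Nat.mul_le_mul_right _ ih
      _ = _ := by ring

lemma ball_card {n d : ℕ} (hd : 3 ≤ d) (G : SimpleGraph (Fin n)) [DecidableRel G.Adj]
    (hreg : ∀ v, G.degree v = d) (v : Fin n) (r : ℕ) :
    (univ.filter fun u => G.edist v u ≤ (r : ℕ∞)).card ≤ 3 * (d - 1) ^ r := by
  induction r with
  | zero =>
    have : (univ.filter fun u => G.edist v u ≤ ((0 : ℕ) : ℕ∞)) ⊆ {v} := by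
      intro u hu
      simp at hu
      simp [hu]
    exact (card_le_card this).trans (by simp)
  | succ r ih =>
    have hsub : (univ.filter fun u => G.edist v u ≤ ((r + 1 : ℕ) : ℕ∞)) ⊆
        (univ.filter fun u => G.edist v u ≤ ((r : ℕ) : ℕ∞)) ∪
        (univ.filter fun u => G.edist v u = ((r + 1 : ℕ) : ℕ∞)) := by
      intro u hu
      simp only [mem_union, mem_filter, mem_univ, true_and] at hu ⊢
      rcases lt_or_eq_of_le hu with h | h
      · left
        push_cast at h
        exact Order.le_of_lt_add_one h
      · exact Or.inr h
    have h1 := (card_le_card hsub).trans (card_union_le _ _)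
    have h2 := sphere_card G hreg v r
    obtain ⟨m, rfl⟩ : ∃ m, d = m + 3 := ⟨d - 3, by omega⟩
    have e : m + 3 - 1 = m + 2 := by omega
    rw [e] at ih h2 ⊢
    have : 3 * (m + 2) ^ r + (m + 3) * (m + 2) ^ r ≤ 3 * (m + 2) ^ (r + 1) := by
      rw [pow_succ]
      nlinarith [Nat.zero_le ((m + 2) ^ r), Nat.zero_le (m * (m + 2) ^ r)]
    omega

lemma edge_ball_card {n d : ℕ} (hd : 3 ≤ d) (G : SimpleGraph (Fin n)) [DecidableRel G.Adj]
    (hreg : ∀ v, G.degree v = d) (e : Sym2 (Fin n)) (r : ℕ) :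
    (univ.filter fun u => edgeDist G u e ≤ (r : ℕ∞)).card ≤ 6 * (d - 1) ^ r := by
  induction e using Sym2.ind with
  | _ a b =>
    have hsub : (univ.filter fun u => edgeDist G u s(a, b) ≤ (r : ℕ∞)) ⊆
        (univ.filter fun u => G.edist a u ≤ (r : ℕ∞)) ∪ (univ.filter fun u => G.edist b u ≤ (r : ℕ∞)) := by
      intro u hu
      simp only [mem_union, mem_filter, mem_univ, true_and] at hu ⊢
      have : min (G.edist u a) (G.edist u b) ≤ (r : ℕ∞) := hu
      rw [min_le_iff, SimpleGraph.edist_comm, SimpleGraph.edist_comm (u := u) (v := b)] at this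
      exact this
    have h1 := (card_le_card hsub).trans (card_union_le _ _)
    have h2 := ball_card hd G hreg a r
    have h3 := ball_card hd G hreg b r
    omega

/-- boundary edges -/
noncomputable def bd {n : ℕ} (G : SimpleGraph (Fin n)) [DecidableRel G.Adj] (A : Finset (Fin n)) :
    Finset (Sym2 (Fin n)) :=
  G.edgeFinset.filter fun e => (∃ a ∈ e, a ∈ A) ∧ ∃ b ∈ e, b ∉ A

/-- close boundary edges -/
noncomputable def cb {n : ℕ} (G : SimpleGraph (Fin n)) [DecidableRel G.Adj] (A : Finset (Fin n))
    (v : Fin n) (r : ℕ) : Finset (Sym2 (Fin n)) :=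
  (bd G A).filter fun e => edgeDist G v e ≤ (r : ℕ∞)

lemma cross {n : ℕ} (G : SimpleGraph (Fin n)) (A : Finset (Fin n)) {v u : Fin n}
    (w : G.Walk v u) (hv : v ∈ A) (hu : u ∉ A) :
    ∃ a b, G.Adj a b ∧ a ∈ A ∧ b ∉ A ∧ ∃ i j : ℕ, G.edist v a ≤ (i : ℕ∞) ∧
      G.edist u b ≤ (j : ℕ∞) ∧ i + 1 + j = w.length := by
  induction w with
  | nil => exact absurd hv hu
  | @cons v x u h p ih =>
    by_cases hx : x ∈ A
    · obtain ⟨a, b, hab, ha, hb, i, j, hi, hj, hij⟩ := ih hx hu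
      refine ⟨a, b, hab, ha, hb, i + 1, j, ?_, hj, by simp; omega⟩
      obtain ⟨w', hw'⟩ := (edist_le_iff G x a i).1 hi
      exact (edist_le_iff G v a (i + 1)).2 ⟨SimpleGraph.Walk.cons h w', by simpa using hw'⟩
    · refine ⟨v, x, h, hv, hx, 0, p.length, by simp, ?_, by simp; omega⟩
      exact (edist_le_iff G u x _).2 ⟨p.reverse, by simp⟩

lemma outside_card {n d : ℕ} (hd : 3 ≤ d) (G : SimpleGraph (Fin n)) [DecidableRel G.Adj]
    (hreg : ∀ v, G.degree v = d) (A : Finset (Fin n)) (v : Fin n) (hv : v ∈ A) (r : ℕ) :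
    (univ.filter fun u => u ∉ A ∧ G.edist v u ≤ (r : ℕ∞)).card ≤
      ∑ i ∈ range r, (cb G A v i).card * (6 * (d - 1) ^ (r - 1 - i)) := by
  have hsub : (univ.filter fun u => u ∉ A ∧ G.edist v u ≤ (r : ℕ∞)) ⊆
      (range r).biUnion fun i => (cb G A v i).biUnion fun e =>
        univ.filter fun u => edgeDist G u e ≤ ((r - 1 - i : ℕ) : ℕ∞) := by
    intro u hu
    simp only [mem_filter, mem_univ, true_and] at hu
    obtain ⟨w, hw⟩ := (edist_le_iff G v u r).1 hu.2
    obtain ⟨a, b, hab, ha, hb, i, j, hi, hj, hij⟩ := cross G A w hv hu.1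
    simp only [mem_biUnion, mem_range]
    refine ⟨i, by omega, s(a, b), ?_, ?_⟩
    · simp only [cb, bd, mem_filter, SimpleGraph.mem_edgeFinset, SimpleGraph.mem_edgeSet]
      refine ⟨⟨hab, ⟨a, by simp, ha⟩, ⟨b, by simp, hb⟩⟩, ?_⟩
      exact min_le_of_left_le hi
    · simp only [mem_filter, mem_univ, true_and]
      refine min_le_of_right_le (hj.trans ?_)
      have : j ≤ r - 1 - i := by omega
      exact_mod_cast this
  refine (card_le_card hsub).trans (card_biUnion_le.trans (sum_le_sum fun i _ => ?_))
  exact card_biUnion_le_card_mul _ _ _ fun e _ => edge_ball_card hd G hreg e _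

/-- threshold -/
noncomputable def th (α : ℝ) (i : ℕ) : ℝ := α / (24 * (((i : ℝ) + 1) * ((i : ℝ) + 2)))

lemma th_pos {α : ℝ} (h : 0 < α) (i : ℕ) : 0 < th α i := by unfold th; positivity

lemma th_sum {α : ℝ} (h : 0 < α) (r : ℕ) : ∑ i ∈ range r, th α i ≤ α / 24 := by
  have : ∑ i ∈ range r, th α i = α / 24 * (1 - 1 / ((r : ℝ) + 1)) := by
    induction r with
    | zero => simp
    | succ r ih =>
      rw [sum_range_succ, ih]
      unfold th
      push_cast
      have h1 : (r : ℝ) + 1 ≠ 0 := by positivity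
      have h2 : (r : ℝ) + 2 ≠ 0 := by positivity
      have h3 : (r : ℝ) + 1 + 1 ≠ 0 := by positivity
      field_simp
      ring
  rw [this]
  have : 0 ≤ 1 / ((r : ℝ) + 1) := by positivity
  nlinarith

lemma outside_bound {n d : ℕ} (hd : 3 ≤ d) {α : ℝ} (hα : 0 < α)
    (G : SimpleGraph (Fin n)) [DecidableRel G.Adj]
    (hreg : ∀ v, G.degree v = d) (A : Finset (Fin n)) (v : Fin n) (hv : v ∈ A) (r : ℕ)
    (h : ∀ i < r + 1, ((cb G A v i).card : ℝ) < th α i * ((d : ℝ) - 1) ^ i) :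
    ((univ.filter fun u => u ∉ A ∧ G.edist v u ≤ ((r + 1 : ℕ) : ℕ∞)).card : ℝ) ≤
      α / 4 * ((d : ℝ) - 1) ^ r := by
  have h0 := outside_card hd G hreg A v hv (r + 1)
  have hx : (0 : ℝ) < (d : ℝ) - 1 := by
    have : (3 : ℝ) ≤ d := by exact_mod_cast hd
    linarith
  have hc : ((d - 1 : ℕ) : ℝ) = (d : ℝ) - 1 := by
    rw [Nat.cast_sub (by omega)]; simp
  have h1 : ((univ.filter fun u => u ∉ A ∧ G.edist v u ≤ ((r + 1 : ℕ) : ℕ∞)).card : ℝ) ≤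
      ∑ i ∈ range (r + 1), ((cb G A v i).card : ℝ) * (6 * ((d : ℝ) - 1) ^ (r + 1 - 1 - i)) := by
    have : ((univ.filter fun u => u ∉ A ∧ G.edist v u ≤ ((r + 1 : ℕ) : ℕ∞)).card : ℝ) ≤
      ((∑ i ∈ range (r + 1), (cb G A v i).card * (6 * (d - 1) ^ (r + 1 - 1 - i)) : ℕ) : ℝ) := by
      exact_mod_cast h0
    refine this.trans (le_of_eq ?_)
    push_cast [hc]
    rfl
  refine h1.trans ?_
  calc _ ≤ ∑ i ∈ range (r + 1), th α i * (6 * ((d : ℝ) - 1) ^ r) := by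
        refine sum_le_sum fun i hi => ?_
        have hi' := mem_range.1 hi
        have := (h i hi').le
        calc _ ≤ th α i * ((d : ℝ) - 1) ^ i * (6 * ((d : ℝ) - 1) ^ (r + 1 - 1 - i)) :=
              mul_le_mul_of_nonneg_right this (by positivity)
          _ = _ := by
            have : ((d : ℝ) - 1) ^ r = ((d : ℝ) - 1) ^ i * ((d : ℝ) - 1) ^ (r + 1 - 1 - i) := by
              rw [← pow_add]; congr 1; omega
            rw [this]; ring
    _ = (∑ i ∈ range (r + 1), th α i) * (6 * ((d : ℝ) - 1) ^ r) := by rw [sum_mul]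
    _ ≤ α / 24 * (6 * ((d : ℝ) - 1) ^ r) :=
        mul_le_mul_of_nonneg_right (th_sum hα _) (by positivity)
    _ = _ := by ring

lemma set_bound {n d : ℕ} (hd : 3 ≤ d) {α : ℝ} (hα : 0 < α) (hα1 : α ≤ 1)
    (G : SimpleGraph (Fin n)) [DecidableRel G.Adj]
    (hreg : ∀ v, G.degree v = d) (hA : ExpanA n d G α)
    (A : Finset (Fin n)) (hcard : (A.card : ℝ) ≤ n / 2) (S : Finset (Fin n)) (hSA : S ⊆ A)
    (hS : S.Nonempty) (r : ℕ)
    (h : ∀ v ∈ S, ∀ i < r, ((cb G A v i).card : ℝ) < th α i * ((d : ℝ) - 1) ^ i) :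
    α * ((d : ℝ) - 1) ^ r * S.card ≤ 3 * n / 4 := by
  have hSc : (S.card : ℝ) ≤ A.card := by exact_mod_cast card_le_card hSA
  have hn : (0 : ℝ) < n := by
    obtain ⟨v, _⟩ := hS
    exact_mod_cast v.pos
  induction r with
  | zero =>
    simp only [pow_zero, mul_one]
    have : α * S.card ≤ 1 * S.card := mul_le_mul_of_nonneg_right hα1 (by positivity)
    linarith
  | succ r ih =>
    have ih := ih fun v hv i hi => h v hv i (by omega)
    by_contra hlt
    push Not at hlt
    have h1 := hA S hS (r + 1) (by omega)
    rw [min_eq_left hlt.le] at h1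
    have hsub : (univ.filter fun v => vertexSetDist G v S ≤ ((r + 1 : ℕ) : ℕ∞)) ⊆
        A ∪ S.biUnion fun v => univ.filter fun u => u ∉ A ∧ G.edist v u ≤ ((r + 1 : ℕ) : ℕ∞) := by
      intro u hu
      simp only [mem_filter, mem_univ, true_and] at hu
      by_cases huA : u ∈ A
      · exact mem_union_left _ huA
      · apply mem_union_right
        obtain ⟨w, hw, hw2⟩ := exists_mem_eq_inf S hS fun w => G.edist u w
        simp only [mem_biUnion, mem_filter, mem_univ, true_and]
        refine ⟨w, hw, huA, ?_⟩
        rw [SimpleGraph.edist_comm, ← hw2]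
        exact hu
    have h2 : ((univ.filter fun v => vertexSetDist G v S ≤ ((r + 1 : ℕ) : ℕ∞)).card : ℝ) ≤
        A.card + ∑ v ∈ S, ((univ.filter fun u => u ∉ A ∧ G.edist v u ≤ ((r + 1 : ℕ) : ℕ∞)).card : ℝ) := by
      exact_mod_cast (card_le_card hsub).trans ((card_union_le _ _).trans
        (Nat.add_le_add_left card_biUnion_le _))
    have h3 : ∑ v ∈ S, ((univ.filter fun u => u ∉ A ∧ G.edist v u ≤ ((r + 1 : ℕ) : ℕ∞)).card : ℝ)
        ≤ S.card * (α / 4 * ((d : ℝ) - 1) ^ r) := by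
      rw [← nsmul_eq_mul]
      exact sum_le_card_nsmul _ _ _ fun v hv =>
        outside_bound hd hα G hreg A v (hSA hv) r (h v hv)
    nlinarith

lemma lev_exists {n d : ℕ} (hd : 3 ≤ d) {α : ℝ} (hα : 0 < α) (hα1 : α ≤ 1)
    (G : SimpleGraph (Fin n)) [DecidableRel G.Adj]
    (hreg : ∀ v, G.degree v = d) (hA : ExpanA n d G α)
    (A : Finset (Fin n)) (hcard : (A.card : ℝ) ≤ n / 2) (v : Fin n) (hv : v ∈ A) :
    ∃ i, th α i * ((d : ℝ) - 1) ^ i ≤ ((cb G A v i).card : ℝ) := by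
  by_contra! hne
  have h1 : ∀ r : ℕ, α * ((d : ℝ) - 1) ^ r ≤ 3 * n / 4 := by
    intro r
    have := set_bound hd hα hα1 G hreg hA A hcard {v} (by simpa using hv) (by simp) r
      (fun w hw i _ => by rw [mem_singleton.1 hw]; exact hne i)
    simpa using this
  have hx : (1 : ℝ) < (d : ℝ) - 1 := by
    have : (3 : ℝ) ≤ d := by exact_mod_cast hd
    linarith
  obtain ⟨r, hr⟩ := pow_unbounded_of_one_lt (3 * (n : ℝ) / 4 / α) hx
  rw [div_lt_iff₀ hα] at hr
  linarith [h1 r]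

lemma peel {n d : ℕ} {α ε L : ℝ} (hα : 0 < α) (hd : 3 ≤ d)
    (G : SimpleGraph (Fin n)) [DecidableRel G.Adj]
    (hB : ExpanB n d G α ε L) (i : ℕ) (hR : 0 ≤ L * ((d : ℝ) - 1 - ε) ^ (i + 1))
    (S : Finset (Fin n))
    (hS : α * ((d : ℝ) - 1) ^ i * S.card ≤ 3 * n / 4) :
    ∃ bad : Fin n → Finset (Sym2 (Fin n)),
      (∀ v ∈ S, (((bad v).filter fun e => e ∈ G.edgeFinset ∧ edgeDist G v e ≤ (i : ℕ∞)).card : ℝ)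
        ≤ L * ((d : ℝ) - 1 - ε) ^ (i + 1)) ∧
      ∀ e ∈ G.edgeFinset, ((S.filter fun v => edgeDist G v e ≤ (i : ℕ∞) ∧ e ∉ bad v).card : ℝ)
        ≤ L * ((d : ℝ) - 1 - ε) ^ (i + 1) := by
  have hx : (0 : ℝ) < (d : ℝ) - 1 := by
    have : (3 : ℝ) ≤ d := by exact_mod_cast hd
    linarith
  induction hm : S.card generalizing S with
  | zero =>
    have : S = ∅ := card_eq_zero.1 hm
    subst this
    exact ⟨fun _ => ∅, by simp, fun _ _ => by simpa using hR⟩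
  | succ m ih =>
    have hne : S.Nonempty := card_pos.1 (by omega)
    obtain ⟨v, hvS, hv⟩ := hB S hne (i + 1) (by omega) (by simpa using hS)
    simp only [Nat.add_sub_cancel] at hv
    set T := G.edgeFinset.filter fun e => L * ((d : ℝ) - 1 - ε) ^ (i + 1) ≤
              ((S.filter fun u => edgeDist G u e ≤ (i : ℕ∞)).card : ℝ) with hT
    have hcE : (S.erase v).card = m := by rw [card_erase_of_mem hvS]; omega
    obtain ⟨bad, hb1, hb2⟩ := ih (S.erase v) (by
      refine le_trans ?_ hS
      have : ((S.erase v).card : ℝ) ≤ S.card := by exact_mod_cast card_le_card (erase_subset _ _)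
      exact mul_le_mul_of_nonneg_left this (by positivity)) hcE
    refine ⟨Function.update bad v T, ?_, ?_⟩
    · intro u hu
      by_cases huv : u = v
      · subst huv
        simp only [Function.update_self]
        refine le_trans ?_ hv
        exact_mod_cast card_le_card fun e he => by
          simp only [mem_filter] at he ⊢
          simp only [hT, mem_filter] at he
          exact ⟨by simpa only [hT, mem_filter] using he.1, he.2.2⟩
      · simp only [Function.update_of_ne huv]
        exact hb1 u (mem_erase.2 ⟨huv, hu⟩)
    · intro e he
      by_cases heT : e ∈ T
      · refine le_trans ?_ (hb2 e he)
        exact_mod_cast card_le_card fun u hu => by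
          simp only [mem_filter, mem_erase] at hu ⊢
          by_cases huv : u = v
          · subst huv
            simp [heT] at hu
          · simp only [Function.update_of_ne huv] at hu
            exact ⟨⟨huv, hu.1⟩, hu.2⟩
      · have : ((S.filter fun u => edgeDist G u e ≤ (i : ℕ∞)).card : ℝ) < L * ((d : ℝ) - 1 - ε) ^ (i + 1) := by
          by_contra hcon
          push Not at hcon
          exact heT (mem_filter.2 ⟨he, hcon⟩)
        refine le_trans ?_ this.le
        exact_mod_cast card_le_card fun u hu => by
          simp only [mem_filter] at hu ⊢
          exact ⟨hu.1, hu.2.1⟩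

/-- good scale -/
def Hg (d : ℕ) (α ε L : ℝ) (i : ℕ) : Prop :=
  L * ((d : ℝ) - 1 - ε) ^ (i + 1) ≤ th α i * ((d : ℝ) - 1) ^ i / 2

/-- multiplicity -/
noncomputable def Rm (d : ℕ) (α ε L : ℝ) (i : ℕ) : ℝ :=
  if Hg d α ε L i then L * ((d : ℝ) - 1 - ε) ^ (i + 1) else 6 * ((d : ℝ) - 1) ^ i

lemma comb {n d : ℕ} (hd : 3 ≤ d) {α ε L : ℝ} (hα : 0 < α) (hα1 : α ≤ 1) (hε : ε ≤ 1)
    (hL : 1 ≤ L)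
    (G : SimpleGraph (Fin n)) [DecidableRel G.Adj]
    (hreg : ∀ v, G.degree v = d) (hE : Expan n d G α ε L)
    (A : Finset (Fin n)) (hcard : (A.card : ℝ) ≤ n / 2) :
    ∃ (lev : Fin n → ℕ) (Et : Fin n → Finset (Sym2 (Fin n))),
      (∀ v ∈ A, (Et v ⊆ cb G A v (lev v)) ∧
        th α (lev v) * ((d : ℝ) - 1) ^ (lev v) / 2 ≤ ((Et v).card : ℝ)) ∧
      ∀ e i, ((A.filter fun v => lev v = i ∧ e ∈ Et v).card : ℝ) ≤ Rm d α ε L i := by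
  have hd3 : (3 : ℝ) ≤ d := by exact_mod_cast hd
  have hx : (0 : ℝ) < (d : ℝ) - 1 := by linarith
  have hy : (0 : ℝ) < (d : ℝ) - 1 - ε := by linarith
  have hL0 : 0 < L := by linarith
  have hex := fun v hv => lev_exists hd hα hα1 G hreg hE.1 A hcard v hv
  let lev : Fin n → ℕ := fun v => if hv : v ∈ A then Nat.find (hex v hv) else 0
  have hlev : ∀ v ∈ A, th α (lev v) * ((d : ℝ) - 1) ^ (lev v) ≤ ((cb G A v (lev v)).card : ℝ) := by
    intro v hv
    simp only [lev, dif_pos hv]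
    exact Nat.find_spec (hex v hv)
  have hlev2 : ∀ v ∈ A, ∀ i < lev v, ((cb G A v i).card : ℝ) < th α i * ((d : ℝ) - 1) ^ i := by
    intro v hv i hi
    simp only [lev, dif_pos hv] at hi
    exact not_le.1 (Nat.find_min (hex v hv) hi)
  have hSb : ∀ i, α * ((d : ℝ) - 1) ^ i * (A.filter fun v => lev v = i).card ≤ 3 * n / 4 := by
    intro i
    rcases (A.filter fun v => lev v = i).eq_empty_or_nonempty with h0 | h0
    · rw [h0]; simp; positivity
    · refine set_bound hd hα hα1 G hreg hE.1 A hcard _ (filter_subset _ _) h0 i ?_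
      intro v hv j hj
      simp only [mem_filter] at hv
      exact hlev2 v hv.1 j (by omega)
  have hp := fun i => peel (ε := ε) (L := L) hα hd G hE.2 i (by positivity) _ (hSb i)
  choose bad hb1 hb2 using hp
  refine ⟨lev, fun v => if Hg d α ε L (lev v) then cb G A v (lev v) \ bad (lev v) v
    else cb G A v (lev v), ?_, ?_⟩
  · intro v hv
    by_cases hH : Hg d α ε L (lev v)
    · simp only [hH, if_true]
      refine ⟨sdiff_subset, ?_⟩
      have h1 := hb1 (lev v) v (mem_filter.2 ⟨hv, rfl⟩)
      have h2 : (cb G A v (lev v)).card ≤ (cb G A v (lev v) \ bad (lev v) v).card +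
        ((bad (lev v) v).filter fun e => e ∈ G.edgeFinset ∧ edgeDist G v e ≤ ((lev v : ℕ) : ℕ∞)).card := by
        refine le_trans (card_le_card ?_) (card_union_le _ _)
        intro e he
        by_cases hbe : e ∈ bad (lev v) v
        · apply mem_union_right
          simp only [cb, bd, mem_filter] at he ⊢
          exact ⟨hbe, he.1.1, he.2⟩
        · exact mem_union_left _ (mem_sdiff.2 ⟨he, hbe⟩)
      have h2' : ((cb G A v (lev v)).card : ℝ) ≤ (cb G A v (lev v) \ bad (lev v) v).card +
        ((bad (lev v) v).filter fun e => e ∈ G.edgeFinset ∧ edgeDist G v e ≤ ((lev v : ℕ) : ℕ∞)).card := by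
        exact_mod_cast h2
      have h3 := hlev v hv
      unfold Hg at hH
      linarith
    · simp only [hH, if_false]
      refine ⟨Subset.refl _, ?_⟩
      have := hlev v hv
      have := th_pos hα (lev v)
      have : 0 < th α (lev v) * ((d : ℝ) - 1) ^ (lev v) := by positivity
      linarith
  · intro e i
    by_cases hH : Hg d α ε L i
    · simp only [Rm, hH, if_true]
      by_cases he : e ∈ G.edgeFinset
      · refine le_trans ?_ (hb2 i e he)
        exact_mod_cast card_le_card fun v hv => by
          simp only [mem_filter] at hv ⊢
          obtain ⟨h1, h2, h3⟩ := hv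
          subst h2
          simp only [hH, if_true, mem_sdiff, cb, mem_filter] at h3
          exact ⟨⟨h1, rfl⟩, h3.1.2, h3.2⟩
      · have : (A.filter fun v => lev v = i ∧ e ∈ (if Hg d α ε L (lev v) then cb G A v (lev v) \ bad (lev v) v
            else cb G A v (lev v))) = ∅ := by
          refine filter_eq_empty_iff.2 ?_
          rintro v hv ⟨h2, h3⟩
          subst h2
          simp only [hH, if_true, mem_sdiff, cb, bd, mem_filter] at h3
          exact he h3.1.1.1
        rw [this]
        simp
        positivity
    · simp only [Rm, hH, if_false]
      have h := edge_ball_card hd G hreg e i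
      have hc : ((d - 1 : ℕ) : ℝ) = (d : ℝ) - 1 := by
        rw [Nat.cast_sub (by omega)]; simp
      rw [← hc]
      have h2 : (A.filter fun v => lev v = i ∧ e ∈ (if Hg d α ε L (lev v) then cb G A v (lev v) \ bad (lev v) v
            else cb G A v (lev v))).card ≤ (univ.filter fun u => edgeDist G u e ≤ (i : ℕ∞)).card := by
        refine card_le_card fun v hv => ?_
        simp only [mem_filter] at hv ⊢
        obtain ⟨h1, h2, h3⟩ := hv
        subst h2
        simp only [hH, if_false, cb, mem_filter] at h3
        exact ⟨mem_univ _, h3.2⟩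
      exact_mod_cast h2.trans h

/-- indicator vector -/
noncomputable def ind {κ : Type} (J : Finset κ) : κ → ℝ := fun a => if a ∈ J then 1 else 0

lemma ind_nonneg {κ : Type} (J : Finset κ) : 0 ≤ ind J := by
  intro a
  simp only [ind, Pi.zero_apply]
  split_ifs <;> norm_num

/-- lattice seminorm on the positive cone with lower `q`-estimate -/
structure Lat (κ : Type) [Fintype κ] (P : (κ → ℝ) → ℝ) (q C : ℝ) : Prop where
  mono : ∀ x y, 0 ≤ x → x ≤ y → P x ≤ P y
  zero : P 0 = 0
  add : ∀ x y, P (x + y) ≤ P x + P y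
  smul : ∀ (c : ℝ) (x), 0 ≤ c → P (c • x) = c * P x
  low : ∀ (m : ℕ) (s : Finset (Fin m)) (x : Fin m → κ → ℝ), (∀ i, 0 ≤ x i) →
    ∑ i ∈ s, P (x i) ^ q ≤ C ^ q * P (∑ i ∈ s, x i) ^ q

lemma Lat.nonneg {κ : Type} [Fintype κ] {P : (κ → ℝ) → ℝ} {q C : ℝ} (h : Lat κ P q C)
    {x : κ → ℝ} (hx : 0 ≤ x) : 0 ≤ P x := by
  rw [← h.zero]; exact h.mono 0 x le_rfl hx

lemma Lat.sum {κ ι : Type} [Fintype κ] {P : (κ → ℝ) → ℝ} {q C : ℝ} (h : Lat κ P q C)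
    (s : Finset ι) (x : ι → κ → ℝ) : P (∑ i ∈ s, x i) ≤ ∑ i ∈ s, P (x i) := by
  induction s using Finset.induction_on with
  | empty => simp [h.zero]
  | insert a s ha ih =>
    rw [sum_insert ha, sum_insert ha]
    exact (h.add _ _).trans (by linarith)

lemma coll_card {n m : ℕ} (v w : Fin n) (hvw : w ≠ v) :
    (univ.filter fun c : Fin n → Fin m => c w = c v).card * m ≤ Fintype.card (Fin n → Fin m) := by
  have : (univ.filter fun c : Fin n → Fin m => c w = c v).card * m =
      ((univ.filter fun c : Fin n → Fin m => c w = c v) ×ˢ (univ : Finset (Fin m))).card := by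
    rw [card_product]; simp
  rw [this, ← card_univ]
  refine card_le_card_of_injOn (fun p => Function.update p.1 w p.2) (by simp) ?_
  rintro ⟨c, t⟩ hc ⟨c', t'⟩ hc' heq
  simp only [coe_product, Set.mem_prod, mem_coe, mem_filter, mem_univ, true_and] at hc hc'
  simp only at heq
  have ht : t = t' := by
    have := congrFun heq w
    simpa using this
  have hne : ∀ u, u ≠ w → c u = c' u := by
    intro u hu
    have := congrFun heq u
    simpa [Function.update_of_ne hu] using this
  have hcc : c = c' := by
    funext u
    by_cases hu : u = w
    · subst hu
      rw [hc.1, hc'.1]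
      exact hne v (Ne.symm hvw)
    · exact hne u hu
  rw [hcc, ht]

lemma colour {n : ℕ} {κ : Type} [Fintype κ] {P : (κ → ℝ) → ℝ} {q C : ℝ} (h : Lat κ P q C)
    (hq : 2 ≤ q) (hC : 1 ≤ C) (s : Finset (Fin n)) (J : Fin n → Finset κ) (D : Finset κ)
    (hJ : ∀ v, J v ⊆ D) (m : ℕ) (hm : 1 ≤ m)
    (hmul : ∀ a, (s.filter fun v => a ∈ J v).card ≤ m) (M : ℝ) (hM : (s.card : ℝ) ≤ M) :
    ∑ v ∈ s, P (ind (J v)) ≤ 2 * (M ^ (1 - 1 / q) * (2 * (m : ℝ)) ^ (1 / q) * C * P (ind D)) := by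
  have hq0 : 0 < q := by linarith
  have hC0 : 0 < C := by linarith
  have hPD : 0 ≤ P (ind D) := h.nonneg (ind_nonneg D)
  have hM0 : 0 ≤ M := le_trans (by positivity) hM
  let Jc : (Fin n → Fin (2 * m)) → Fin n → Finset κ := fun c v =>
    (J v).filter fun a => ∀ w ∈ s, w ≠ v → a ∈ J w → c w ≠ c v
  -- step 1
  have s1 : ∀ c, ∑ v ∈ s, P (ind (Jc c v)) ^ q ≤ (2 * (m : ℝ)) * (C ^ q * P (ind D) ^ q) := by
    intro c
    have hfib : ∑ v ∈ s, P (ind (Jc c v)) ^ q =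
        ∑ t : Fin (2 * m), ∑ v ∈ s.filter (fun v => c v = t), P (ind (Jc c v)) ^ q :=
      (sum_fiberwise s c _).symm
    rw [hfib]
    have : ∀ t ∈ (univ : Finset (Fin (2 * m))),
        ∑ v ∈ s.filter (fun v => c v = t), P (ind (Jc c v)) ^ q ≤ C ^ q * P (ind D) ^ q := by
      intro t _
      refine (h.low n _ _ fun i => ind_nonneg _).trans ?_
      refine mul_le_mul_of_nonneg_left ?_ (by positivity)
      refine Real.rpow_le_rpow (h.nonneg (sum_nonneg fun i _ => ind_nonneg _)) ?_ hq0.le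
      refine h.mono _ _ (sum_nonneg fun i _ => ind_nonneg _) ?_
      intro a
      rw [Finset.sum_apply]
      simp only [ind]
      rw [sum_ite, sum_const_zero, add_zero, sum_const, nsmul_eq_mul, mul_one]
      have hle : (filter (fun v => a ∈ Jc c v) (s.filter fun v => c v = t)).card ≤ 1 := by
        rw [card_le_one]
        intro v hv w hw
        simp only [mem_filter, Jc] at hv hw
        by_contra hne
        exact hv.2.2 w hw.1.1 (Ne.symm hne) hw.2.1 (hw.1.2.trans hv.1.2.symm)
      split_ifs with haD
      · exact_mod_cast hle
      · have : filter (fun v => a ∈ Jc c v) (s.filter fun v => c v = t) = ∅ := by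
          refine filter_eq_empty_iff.2 fun v _ hv => haD (hJ v ?_)
          exact (mem_filter.1 hv).1
        rw [this]; simp
    refine (sum_le_card_nsmul _ _ _ this).trans (le_of_eq ?_)
    rw [nsmul_eq_mul]; simp
  -- step 2
  have s2 : ∀ c, ∑ v ∈ s, P (ind (Jc c v)) ≤
      M ^ (1 - 1 / q) * (2 * (m : ℝ)) ^ (1 / q) * C * P (ind D) := by
    intro c
    have hX : 0 ≤ ∑ v ∈ s, P (ind (Jc c v)) := sum_nonneg fun v _ => h.nonneg (ind_nonneg _)
    have hpow : (∑ v ∈ s, P (ind (Jc c v))) ^ q ≤ (s.card : ℝ) ^ (q - 1) * ∑ v ∈ s, P (ind (Jc c v)) ^ q :=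
      Real.rpow_sum_le_const_mul_sum_rpow_of_nonneg s (by linarith)
        fun v _ => h.nonneg (ind_nonneg _)
    have hpow2 : (∑ v ∈ s, P (ind (Jc c v))) ^ q ≤
        M ^ (q - 1) * ((2 * (m : ℝ)) * (C ^ q * P (ind D) ^ q)) := by
      refine hpow.trans (mul_le_mul (Real.rpow_le_rpow (by positivity) hM (by linarith)) (s1 c) ?_
        (by positivity))
      exact sum_nonneg fun v _ => Real.rpow_nonneg (h.nonneg (ind_nonneg _)) _
    have hr := Real.rpow_le_rpow (by positivity) hpow2 (z := 1 / q) (by positivity)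
    have e1 : ((∑ v ∈ s, P (ind (Jc c v))) ^ q) ^ (1 / q) = ∑ v ∈ s, P (ind (Jc c v)) := by
      rw [← Real.rpow_mul hX, mul_one_div_cancel hq0.ne', Real.rpow_one]
    rw [e1] at hr
    refine hr.trans (le_of_eq ?_)
    rw [Real.mul_rpow (by positivity) (by positivity), Real.mul_rpow (by positivity) (by positivity),
      Real.mul_rpow (x := C ^ q) (by positivity) (by positivity), ← Real.rpow_mul hM0, ← Real.rpow_mul hC0.le,
      ← Real.rpow_mul hPD, mul_one_div_cancel hq0.ne', Real.rpow_one, Real.rpow_one]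
    have : (q - 1) * (1 / q) = 1 - 1 / q := by field_simp
    rw [this]; ring
  -- step 3
  set T : ℕ := Fintype.card (Fin n → Fin (2 * m)) with hT
  have hTpos : 0 < T := by
    rw [hT]
    have : Nonempty (Fin (2 * m)) := ⟨⟨0, by omega⟩⟩
    exact Fintype.card_pos
  have hTR : (0 : ℝ) < T := by exact_mod_cast hTpos
  have s3 : ∀ v ∈ s, ind (J v) ≤ ∑ c : Fin n → Fin (2 * m), ((2 : ℝ) / T) • ind (Jc c v) := by
    intro v hv a
    rw [Finset.sum_apply]
    by_cases ha : a ∈ J v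
    · simp only [ind, ha, if_true, Pi.smul_apply, smul_eq_mul]
      rw [← mul_sum, sum_ite, sum_const_zero, add_zero, sum_const, nsmul_eq_mul, mul_one]
      have hbad : (univ.filter fun c : Fin n → Fin (2 * m) => ¬ a ∈ Jc c v).card * 2 ≤ T := by
        have hsub : (univ.filter fun c : Fin n → Fin (2 * m) => ¬ a ∈ Jc c v) ⊆
            ((s.filter fun w => a ∈ J w).erase v).biUnion fun w =>
              univ.filter fun c : Fin n → Fin (2 * m) => c w = c v := by
          intro c hc
          simp only [mem_filter, mem_univ, true_and, Jc, ha, not_forall] at hc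
          obtain ⟨w, hw, hwv, haw, hcw⟩ := hc
          simp only [mem_biUnion, mem_erase, mem_filter, mem_univ, true_and]
          exact ⟨w, ⟨hwv, hw, haw⟩, not_not.1 hcw⟩
        have hcard : (univ.filter fun c : Fin n → Fin (2 * m) => ¬ a ∈ Jc c v).card * (2 * m) ≤ m * T := by
          calc _ ≤ (∑ w ∈ (s.filter fun w => a ∈ J w).erase v,
                (univ.filter fun c : Fin n → Fin (2 * m) => c w = c v).card) * (2 * m) :=
                Nat.mul_le_mul_right _ ((card_le_card hsub).trans card_biUnion_le)
            _ = ∑ w ∈ (s.filter fun w => a ∈ J w).erase v,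
                (univ.filter fun c : Fin n → Fin (2 * m) => c w = c v).card * (2 * m) := by
                rw [sum_mul]
            _ ≤ ((s.filter fun w => a ∈ J w).erase v).card • T := by
                refine sum_le_card_nsmul _ _ _ fun w hw => ?_
                exact coll_card v w (mem_erase.1 hw).1
            _ ≤ m * T := by
                rw [smul_eq_mul]
                exact Nat.mul_le_mul_right _ ((card_le_card (erase_subset _ _)).trans (hmul a))
        have : m * ((univ.filter fun c : Fin n → Fin (2 * m) => ¬ a ∈ Jc c v).card * 2) ≤ m * T := by
          calc _ = _ := by ring
            _ ≤ _ := hcard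
        exact Nat.le_of_mul_le_mul_left this hm
      have htot := card_filter_add_card_filter_not (s := (univ : Finset (Fin n → Fin (2 * m))))
        (fun c => a ∈ Jc c v)
      rw [card_univ, ← hT] at htot
      have hgood : T ≤ 2 * (univ.filter fun c : Fin n → Fin (2 * m) => a ∈ Jc c v).card := by omega
      have hgood' : (T : ℝ) ≤ 2 * (univ.filter fun c : Fin n → Fin (2 * m) => a ∈ Jc c v).card := by
        exact_mod_cast hgood
      rw [div_mul_eq_mul_div, le_div_iff₀ hTR]
      linarith
    · have : ind (J v) a = 0 := by simp [ind, ha]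
      rw [this]
      refine sum_nonneg fun c _ => ?_
      exact mul_nonneg (by positivity) (ind_nonneg _ a)
  calc ∑ v ∈ s, P (ind (J v)) ≤ ∑ v ∈ s, ∑ c : Fin n → Fin (2 * m), (2 : ℝ) / T * P (ind (Jc c v)) := by
        refine sum_le_sum fun v hv => ?_
        refine (h.mono _ _ (ind_nonneg _) (s3 v hv)).trans ((h.sum _ _).trans ?_)
        refine sum_le_sum fun c _ => ?_
        rw [h.smul _ _ (by positivity)]
    _ = ∑ c : Fin n → Fin (2 * m), (2 : ℝ) / T * ∑ v ∈ s, P (ind (Jc c v)) := by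
        rw [sum_comm]
        simp only [mul_sum]
    _ ≤ ∑ c : Fin n → Fin (2 * m), (2 : ℝ) / T *
          (M ^ (1 - 1 / q) * (2 * (m : ℝ)) ^ (1 / q) * C * P (ind D)) :=
        sum_le_sum fun c _ => mul_le_mul_of_nonneg_left (s2 c) (by positivity)
    _ = _ := by
        rw [sum_const, nsmul_eq_mul, card_univ, ← hT]
        field_simp

/-- scale term -/
noncomputable def tm (d : ℕ) (q C α ε L : ℝ) (i : ℕ) : ℝ :=
  (th α i * ((d : ℝ) - 1) ^ i / 2)⁻¹ *
    (2 * ((6 * ((d : ℝ) - 1) ^ i) ^ (1 - 1 / q) * (2 * Rm d α ε L i) ^ (1 / q) * C))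

lemma Rm_ge {d : ℕ} (hd : 3 ≤ d) {α ε L : ℝ} (hε : ε ≤ 1) (hL : 1 ≤ L) (i : ℕ) :
    1 ≤ Rm d α ε L i := by
  have hd3 : (3 : ℝ) ≤ d := by exact_mod_cast hd
  unfold Rm
  split_ifs
  · have : (1 : ℝ) ≤ ((d : ℝ) - 1 - ε) ^ (i + 1) := one_le_pow₀ (by linarith)
    nlinarith
  · have : (1 : ℝ) ≤ ((d : ℝ) - 1) ^ i := one_le_pow₀ (by linarith)
    linarith

lemma core {n d : ℕ} (hd : 3 ≤ d) {q C α ε L : ℝ} (hq : 2 ≤ q) (hC : 1 ≤ C)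
    (hα : 0 < α) (hα1 : α ≤ 1) (hε : ε ≤ 1) (hL : 1 ≤ L)
    (G : SimpleGraph (Fin n)) [DecidableRel G.Adj]
    (hreg : ∀ v, G.degree v = d) (hE : Expan n d G α ε L)
    {κ : Type} [Fintype κ] {P : (κ → ℝ) → ℝ} (h : Lat κ P q C)
    (A : κ → Finset (Fin n)) (hA : ∀ a, ((A a).card : ℝ) ≤ n / 2)
    (B : ℝ) (hB : ∀ I : ℕ, ∑ i ∈ range I, tm d q C α ε L i ≤ B) :
    ∑ v, P (ind (univ.filter fun a => v ∈ A a)) ≤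
      B * ∑ e ∈ G.edgeFinset, P (ind (univ.filter fun a => e ∈ bd G (A a))) := by
  have hd3 : (3 : ℝ) ≤ d := by exact_mod_cast hd
  have hx : (0 : ℝ) < (d : ℝ) - 1 := by linarith
  have hc := fun a => comb hd hα hα1 hε hL G hreg hE (A a) (hA a)
  choose lev Et h1 h2 using hc
  obtain ⟨I, hI⟩ : ∃ I : ℕ, ∀ a v, lev a v < I := by
    refine ⟨(∑ a, ∑ v, lev a v) + 1, fun a v => Nat.lt_succ_of_le ?_⟩
    exact (single_le_sum (f := fun v => lev a v) (fun _ _ => Nat.zero_le _) (mem_univ v)).trans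
      (single_le_sum (f := fun a => ∑ v, lev a v) (fun _ _ => Nat.zero_le _) (mem_univ a))
  let J : Fin n → ℕ → Sym2 (Fin n) → Finset κ := fun v i e =>
    univ.filter fun a => v ∈ A a ∧ lev a v = i ∧ e ∈ Et a v
  let D : ℕ → ℝ := fun i => th α i * ((d : ℝ) - 1) ^ i / 2
  have hD : ∀ i, 0 < D i := fun i => by
    have := th_pos hα i
    simp only [D]; positivity
  have hpt : ∀ v, ind (univ.filter fun a => v ∈ A a) ≤
      ∑ i ∈ range I, ∑ e ∈ G.edgeFinset.filter (fun e => edgeDist G v e ≤ (i : ℕ∞)),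
        (D i)⁻¹ • ind (J v i e) := by
    intro v a
    have hnn : ∀ i ∈ range I, (0 : ℝ) ≤ (∑ e ∈ G.edgeFinset.filter (fun e => edgeDist G v e ≤ (i : ℕ∞)),
        (D i)⁻¹ • ind (J v i e)) a := by
      intro i _
      rw [Finset.sum_apply]
      exact sum_nonneg fun e _ => mul_nonneg (inv_nonneg.2 (hD i).le) (ind_nonneg _ a)
    rw [Finset.sum_apply]
    by_cases ha : v ∈ A a
    · refine le_trans ?_ (single_le_sum hnn (mem_range.2 (hI a v)))
      rw [Finset.sum_apply]
      simp only [ind, ha, mem_filter, mem_univ, true_and, if_true, Pi.smul_apply, smul_eq_mul, J]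
      rw [← mul_sum, sum_ite, sum_const_zero, add_zero, sum_const, nsmul_eq_mul, mul_one]
      have hsub : Et a v ⊆ filter (fun e => e ∈ Et a v)
          (G.edgeFinset.filter (fun e => edgeDist G v e ≤ (lev a v : ℕ∞))) := by
        intro e he
        have := (h1 a v ha).1 he
        simp only [cb, bd, mem_filter] at this ⊢
        exact ⟨⟨this.1.1, this.2⟩, he⟩
      have h3 : ((Et a v).card : ℝ) ≤ (filter (fun e => e ∈ Et a v)
          (G.edgeFinset.filter (fun e => edgeDist G v e ≤ (lev a v : ℕ∞)))).card := by
        exact_mod_cast card_le_card hsub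
      have h4 : D (lev a v) ≤ _ := (h1 a v ha).2.trans h3
      rw [inv_mul_eq_div, le_div_iff₀ (hD _), one_mul]
      exact h4
    · have : ind (univ.filter fun a => v ∈ A a) a = 0 := by simp [ind, ha]
      rw [this]
      exact sum_nonneg hnn
  have hedge : ∀ i : ℕ, ∀ e ∈ G.edgeFinset,
      ∑ v ∈ univ.filter (fun v => edgeDist G v e ≤ (i : ℕ∞)), (D i)⁻¹ * P (ind (J v i e)) ≤
        tm d q C α ε L i * P (ind (univ.filter fun a => e ∈ bd G (A a))) := by
    intro i e he
    have hR1 := Rm_ge (α := α) hd hε hL i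
    have hcol := colour h hq hC (univ.filter (fun v => edgeDist G v e ≤ (i : ℕ∞)))
      (fun v => J v i e) (univ.filter fun a => e ∈ bd G (A a)) (by
        intro v a ha
        simp only [J, mem_filter, mem_univ, true_and] at ha ⊢
        exact (mem_filter.1 ((h1 a v ha.1).1 ha.2.2)).1) ⌊Rm d α ε L i⌋₊
      (Nat.le_floor (by simpa using hR1)) (by
        intro a
        refine Nat.le_floor (le_trans ?_ (h2 a e i))
        exact_mod_cast card_le_card fun v hv => by
          simp only [J, mem_filter, mem_univ, true_and] at hv ⊢
          exact ⟨hv.2.1, hv.2.2⟩) (6 * ((d : ℝ) - 1) ^ i) (by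
        have hb := edge_ball_card hd G hreg e i
        have hc : ((d - 1 : ℕ) : ℝ) = (d : ℝ) - 1 := by
          rw [Nat.cast_sub (by omega)]; simp
        rw [← hc]
        exact_mod_cast hb)
    rw [← mul_sum]
    unfold tm
    rw [mul_assoc]
    refine mul_le_mul_of_nonneg_left (hcol.trans ?_) (inv_nonneg.2 (hD i).le)
    have hfl : ((⌊Rm d α ε L i⌋₊ : ℕ) : ℝ) ≤ Rm d α ε L i := Nat.floor_le (by linarith)
    have hP := h.nonneg (ind_nonneg (univ.filter fun a => e ∈ bd G (A a)))
    have hq0 : 0 < q := by linarith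
    have hrp : (2 * ((⌊Rm d α ε L i⌋₊ : ℕ) : ℝ)) ^ (1 / q) ≤ (2 * Rm d α ε L i) ^ (1 / q) :=
      Real.rpow_le_rpow (by positivity) (by linarith) (by positivity)
    have hC0 : 0 ≤ C := by linarith
    rw [mul_assoc 2]
    gcongr
  calc ∑ v, P (ind (univ.filter fun a => v ∈ A a))
      ≤ ∑ v, ∑ i ∈ range I, ∑ e ∈ G.edgeFinset.filter (fun e => edgeDist G v e ≤ (i : ℕ∞)),
        (D i)⁻¹ * P (ind (J v i e)) := by
        refine sum_le_sum fun v _ => ?_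
        refine (h.mono _ _ (ind_nonneg _) (hpt v)).trans ((h.sum _ _).trans ?_)
        refine sum_le_sum fun i _ => (h.sum _ _).trans (le_of_eq ?_)
        exact sum_congr rfl fun e _ => h.smul _ _ (inv_nonneg.2 (hD i).le)
    _ = ∑ i ∈ range I, ∑ e ∈ G.edgeFinset,
          ∑ v ∈ univ.filter (fun v => edgeDist G v e ≤ (i : ℕ∞)), (D i)⁻¹ * P (ind (J v i e)) := by
        rw [sum_comm]
        refine sum_congr rfl fun i _ => ?_
        simp only [sum_filter]
        rw [sum_comm]
    _ ≤ ∑ i ∈ range I, ∑ e ∈ G.edgeFinset,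
          tm d q C α ε L i * P (ind (univ.filter fun a => e ∈ bd G (A a))) :=
        sum_le_sum fun i _ => sum_le_sum fun e he => hedge i e he
    _ = (∑ i ∈ range I, tm d q C α ε L i) *
          ∑ e ∈ G.edgeFinset, P (ind (univ.filter fun a => e ∈ bd G (A a))) := by
        simp only [← mul_sum]
        rw [sum_mul]
    _ ≤ _ := mul_le_mul_of_nonneg_right (hB I) (sum_nonneg fun e _ => h.nonneg (ind_nonneg _))

lemma tm_le {d : ℕ} (hd : 3 ≤ d) {q C α ε L : ℝ} (hq : 2 ≤ q) (hC : 1 ≤ C)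
    (hα : 0 < α) (hα1 : α ≤ 1) (hε0 : 0 < ε) (hε : ε ≤ 1) (hL : 1 ≤ L) (i : ℕ) :
    tm d q C α ε L i ≤ 55296 * C * L * ((d : ℝ) - 1) / α ^ 2 *
      ((((i : ℝ) + 1) * ((i : ℝ) + 2)) ^ 2 * (1 - ε / ((d : ℝ) - 1) / q) ^ i) := by
  have hd3 : (3 : ℝ) ≤ d := by exact_mod_cast hd
  obtain ⟨x, hx⟩ : ∃ x : ℝ, (d : ℝ) - 1 = x := ⟨_, rfl⟩
  have hx2 : 2 ≤ x := by linarith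
  have hx0 : 0 < x := by linarith
  have hq0 : 0 < q := by linarith
  have hC0 : 0 < C := by linarith
  have hL0 : 0 < L := by linarith
  have hR1 := Rm_ge (α := α) hd hε hL i
  set R := Rm d α ε L i with hR
  unfold tm
  rw [← hR, hx]
  set z : ℝ := ((i : ℝ) + 1) * ((i : ℝ) + 2) with hz
  have hz0 : 0 < z := by positivity
  have hz1 : 1 ≤ z := by rw [hz]; nlinarith [(Nat.cast_nonneg i : (0 : ℝ) ≤ i)]
  have hX : 0 < x ^ i := by positivity
  set δ := ε / x with hδ
  have hδ0 : 0 < δ := by positivity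
  have hδ1 : δ < 1 := by rw [hδ, div_lt_one hx0]; linarith
  set y := 1 - δ / q with hy
  have hdq : δ / q ≤ δ := div_le_self hδ0.le (by linarith)
  have hy0 : 0 < y := by rw [hy]; linarith
  have hxδ : x - ε = x * (1 - δ) := by rw [hδ]; field_simp
  have key : (2 * R / (6 * x ^ i)) ^ (1 / q) ≤ 96 * z * L * x / α * y ^ i := by
    have hq1 : 1 / q ≤ 1 := by rw [div_le_one hq0]; linarith
    have hq1' : 0 ≤ 1 / q := by positivity
    by_cases hH : Hg d α ε L i
    · have : R = L * (x * (1 - δ)) ^ (i + 1) := by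
        rw [hR, Rm, if_pos hH, hx, hxδ]
      have e1 : 2 * R / (6 * x ^ i) ≤ (L * x) * (1 - δ) ^ i := by
        rw [this, div_le_iff₀ (by positivity), mul_pow, pow_succ, pow_succ (1 - δ)]
        have h1 : 0 < (1 - δ) ^ i := pow_pos (by linarith) i
        have h2 : 0 < L * (x ^ i * x) * (1 - δ) ^ i := by positivity
        nlinarith
      have hLx : 1 ≤ L * x := by nlinarith
      calc _ ≤ ((L * x) * (1 - δ) ^ i) ^ (1 / q) :=
            Real.rpow_le_rpow (by positivity) e1 hq1'
        _ = (L * x) ^ (1 / q) * ((1 - δ) ^ (1 / q)) ^ i := by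
            rw [Real.mul_rpow (by positivity) (pow_nonneg (by linarith) _)]
            congr 1
            rw [← Real.rpow_natCast, ← Real.rpow_natCast, ← Real.rpow_mul (by linarith),
              ← Real.rpow_mul (by linarith), mul_comm]
        _ ≤ (L * x) * y ^ i := by
            refine mul_le_mul ?_ ?_ (pow_nonneg (Real.rpow_nonneg (by linarith) _) _) (by positivity)
            · calc (L * x) ^ (1 / q) ≤ (L * x) ^ (1 : ℝ) := Real.rpow_le_rpow_of_exponent_le hLx hq1
                _ = _ := Real.rpow_one _
            · refine pow_le_pow_left₀ (Real.rpow_nonneg (by linarith) _) ?_ i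
              have := rpow_one_add_le_one_add_mul_self (s := -δ) (by linarith) hq1' hq1
              rw [hy]
              calc (1 - δ) ^ (1 / q) = (1 + -δ) ^ (1 / q) := by ring_nf
                _ ≤ _ := this
                _ = _ := by ring
        _ ≤ _ := by
            refine mul_le_mul_of_nonneg_right ?_ (by positivity)
            rw [le_div_iff₀ hα]
            have : L * x * α ≤ L * x * 1 := mul_le_mul_of_nonneg_left hα1 (by positivity)
            have : L * x * 1 ≤ L * x * z := mul_le_mul_of_nonneg_left hz1 (by positivity)
            have : 0 < L * x * z := by positivity
            nlinarith
    · have : R = 6 * x ^ i := by rw [hR, Rm, if_neg hH, hx]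
      have e1 : 2 * R / (6 * x ^ i) = 2 := by rw [this]; field_simp
      rw [e1]
      have e2 : (2 : ℝ) ^ (1 / q) ≤ 2 := by
        calc (2 : ℝ) ^ (1 / q) ≤ 2 ^ (1 : ℝ) := Real.rpow_le_rpow_of_exponent_le (by norm_num) hq1
          _ = 2 := Real.rpow_one _
      refine e2.trans ?_
      unfold Hg th at hH
      rw [not_le, hx, hxδ, ← hz, mul_pow] at hH
      have h1 : (1 - δ) ^ (i + 1) ≤ y ^ i := by
        calc (1 - δ) ^ (i + 1) ≤ (1 - δ) ^ i :=
              pow_le_pow_of_le_one (by linarith) (by linarith) (by omega)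
          _ ≤ y ^ i := pow_le_pow_left₀ (by linarith) (by rw [hy]; linarith) i
      have h2 : α / (24 * z) * x ^ i / 2 < L * (x ^ (i + 1) * y ^ i) :=
        hH.trans_le (by gcongr)
      have h3 : α / (24 * z) * x ^ i / 2 = (α / (48 * z)) * x ^ i := by field_simp; norm_num
      have h4 : L * (x ^ (i + 1) * y ^ i) = (L * x * y ^ i) * x ^ i := by ring
      rw [h3, h4] at h2
      have h5 := lt_of_mul_lt_mul_right h2 hX.le
      rw [div_lt_iff₀ (by positivity)] at h5
      rw [div_mul_eq_mul_div, le_div_iff₀ hα]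
      nlinarith
  have hsplit : (6 * x ^ i) ^ (1 - 1 / q) * (2 * R) ^ (1 / q) =
      6 * x ^ i * (2 * R / (6 * x ^ i)) ^ (1 / q) := by
    rw [Real.rpow_sub (by positivity), Real.rpow_one, Real.div_rpow (by positivity) (by positivity)]
    ring
  rw [hsplit]
  have hth : th α i = α / (24 * z) := rfl
  rw [hth]
  calc _ = 576 * z * C / α * (2 * R / (6 * x ^ i)) ^ (1 / q) := by
        field_simp
        norm_num
    _ ≤ 576 * z * C / α * (96 * z * L * x / α * y ^ i) :=
        mul_le_mul_of_nonneg_left key (by positivity)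
    _ = _ := by
        field_simp
        norm_num

/-- the constant -/
noncomputable def Bc (d : ℕ) (q C α ε L : ℝ) : ℝ :=
  55296 * C * L * ((d : ℝ) - 1) / α ^ 2 * (24 * (q * ((d : ℝ) - 1) / ε) ^ 5)

lemma tm_sum {d : ℕ} (hd : 3 ≤ d) {q C α ε L : ℝ} (hq : 2 ≤ q) (hC : 1 ≤ C)
    (hα : 0 < α) (hα1 : α ≤ 1) (hε0 : 0 < ε) (hε : ε ≤ 1) (hL : 1 ≤ L) (I : ℕ) :
    ∑ i ∈ range I, tm d q C α ε L i ≤ Bc d q C α ε L := by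
  have hd3 : (3 : ℝ) ≤ d := by exact_mod_cast hd
  have hx0 : 0 < (d : ℝ) - 1 := by linarith
  have hq0 : 0 < q := by linarith
  have hC0 : 0 < C := by linarith
  have hL0 : 0 < L := by linarith
  refine (sum_le_sum fun i _ => tm_le hd hq hC hα hα1 hε0 hε hL i).trans ?_
  rw [← mul_sum]
  unfold Bc
  refine mul_le_mul_of_nonneg_left ?_ (by positivity)
  set δ := ε / ((d : ℝ) - 1) / q with hδ
  have hδ0 : 0 < δ := by positivity
  have hδ1 : δ < 1 := by
    rw [hδ, div_div, div_lt_one (by positivity)]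
    nlinarith
  have hnorm : ‖(1 - δ)‖ < 1 := by
    rw [Real.norm_eq_abs, abs_of_pos (by linarith)]; linarith
  have hsum := hasSum_choose_mul_geometric_of_norm_lt_one 4 hnorm
  have h1 := sum_le_hasSum (range I) (fun i _ => mul_nonneg (Nat.cast_nonneg _) (pow_nonneg (by linarith) i)) hsum
  have h2 : ∀ i ∈ range I, (((i : ℝ) + 1) * ((i : ℝ) + 2)) ^ 2 * (1 - δ) ^ i ≤
      24 * (((i + 4).choose 4 : ℕ) * (1 - δ) ^ i) := by
    intro i _
    rw [← mul_assoc]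
    refine mul_le_mul_of_nonneg_right ?_ (pow_nonneg (by linarith) i)
    have h3 : 24 * (i + 4).choose 4 = (i + 1) * (i + 2) * (i + 3) * (i + 4) := by
      have := Nat.descFactorial_eq_factorial_mul_choose (i + 4) 4
      simp [Nat.descFactorial, Nat.factorial] at this
      rw [← this]
      ring
    have h4 : (24 : ℝ) * ((i + 4).choose 4 : ℕ) = ((i : ℝ) + 1) * (i + 2) * (i + 3) * (i + 4) := by
      exact_mod_cast h3
    rw [h4]
    have hi : (0 : ℝ) ≤ i := Nat.cast_nonneg i
    have h5 : (0 : ℝ) ≤ (i + 1) * (i + 2) := by positivity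
    nlinarith
  refine (sum_le_sum h2).trans ?_
  rw [← mul_sum]
  refine mul_le_mul_of_nonneg_left (h1.trans (le_of_eq ?_)) (by norm_num)
  rw [hδ]
  have : (1 - (1 - ε / ((d : ℝ) - 1) / q)) = (q * ((d : ℝ) - 1) / ε)⁻¹ := by
    field_simp
    ring
  rw [this, inv_pow, one_div, inv_inv]

lemma N_zero {k : ℕ} {N : (Fin k → ℝ) → ℝ} (hN : IsNorm k N) : N 0 = 0 := (hN.1 0).2 rfl

lemma N_neg {k : ℕ} {N : (Fin k → ℝ) → ℝ} (hN : IsNorm k N) (x : Fin k → ℝ) : N (-x) = N x := by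
  have := hN.2.1 (-1) x
  simpa using this

lemma N_nonneg {k : ℕ} {N : (Fin k → ℝ) → ℝ} (hN : IsNorm k N) (x : Fin k → ℝ) : 0 ≤ N x := by
  have h := hN.2.2 x (-x)
  rw [add_neg_cancel, N_zero hN, N_neg hN] at h
  linarith

lemma N_step {k : ℕ} {N : (Fin k → ℝ) → ℝ} (hN : IsNorm k N) (hunc : OneUnconditional k N)
    (y : Fin k → ℝ) (j : Fin k) (t : ℝ) (ht : |t| ≤ |y j|) : N (Function.update y j t) ≤ N y := by
  by_cases hy : y j = 0
  · have : t = 0 := by simpa [hy] using ht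
    have h2 : Function.update y j t = y := by rw [this, ← hy, Function.update_eq_self]
    rw [h2]
  · have hflip : N (Function.update y j (-(y j))) = N y := by
      rw [hunc (Function.update y j (-(y j))), hunc y]
      congr 1
      funext i
      by_cases hi : i = j
      · subst hi; simp
      · simp [Function.update_of_ne hi]
    obtain ⟨c, hc⟩ : ∃ c, t = c * y j := ⟨t / y j, by field_simp⟩
    have hc1 : |c| ≤ 1 := by
      rw [hc, abs_mul] at ht
      have : 0 < |y j| := abs_pos.2 hy
      by_contra hlt
      push Not at hlt
      nlinarith
    have hc2 := abs_le.1 hc1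
    have hdec : Function.update y j t =
        ((1 + c) / 2) • y + ((1 - c) / 2) • Function.update y j (-(y j)) := by
      funext i
      by_cases hi : i = j
      · subst hi; simp [hc]; ring
      · simp [Function.update_of_ne hi]; ring
    rw [hdec]
    refine (hN.2.2 _ _).trans ?_
    rw [hN.2.1, hN.2.1, hflip, abs_of_nonneg (by linarith), abs_of_nonneg (by linarith)]
    linarith

lemma N_mono {k : ℕ} {N : (Fin k → ℝ) → ℝ} (hN : IsNorm k N) (hunc : OneUnconditional k N)
    (x y : Fin k → ℝ) (h : ∀ j, |x j| ≤ |y j|) : N x ≤ N y := by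
  have key : ∀ s : Finset (Fin k), N (s.piecewise x y) ≤ N y := by
    intro s
    induction s using Finset.induction_on with
    | empty => simp
    | insert a s ha ih =>
      rw [piecewise_insert]
      refine (N_step hN hunc _ a (x a) ?_).trans ih
      simpa [ha] using h a
  simpa using key univ

/-- weighted lattice norm -/
noncomputable def PW {k : ℕ} (N : (Fin k → ℝ) → ℝ) {κ : Type} [Fintype κ] (W : Fin k → κ → ℝ)
    (y : κ → ℝ) : ℝ := N fun j => ∑ a, W j a * y a

lemma PW_lat {k : ℕ} {N : (Fin k → ℝ) → ℝ} {q C : ℝ} (hq : 2 ≤ q) (hC : 1 ≤ C)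
    (hN : IsNorm k N) (hunc : OneUnconditional k N)
    (hcot : HasCotype k N q C) {κ : Type} [Fintype κ] (W : Fin k → κ → ℝ) (hW : ∀ j a, 0 ≤ W j a) :
    Lat κ (PW N W) q C := by
  have hq0 : 0 < q := by linarith
  have hC0 : 0 < C := by linarith
  refine ⟨?_, ?_, ?_, ?_, ?_⟩
  · intro x y hx hxy
    refine N_mono hN hunc _ _ fun j => ?_
    have h1 : 0 ≤ ∑ a, W j a * x a := sum_nonneg fun a _ => mul_nonneg (hW j a) (hx a)
    have h2 : ∑ a, W j a * x a ≤ ∑ a, W j a * y a :=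
      sum_le_sum fun a _ => mul_le_mul_of_nonneg_left (hxy a) (hW j a)
    rw [abs_of_nonneg h1, abs_of_nonneg (h1.trans h2)]
    exact h2
  · unfold PW
    rw [← N_zero hN]
    congr 1
    funext j
    simp
  · intro x y
    unfold PW
    refine le_trans (le_of_eq ?_) (hN.2.2 _ _)
    congr 1
    funext j
    simp [mul_add, sum_add_distrib]
  · intro c x hc
    unfold PW
    rw [← abs_of_nonneg hc, ← hN.2.1, abs_of_nonneg hc]
    congr 1
    funext j
    simp only [Pi.smul_apply, smul_eq_mul, mul_sum]
    exact sum_congr rfl fun a _ => by ring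
  · intro m s x hx
    let z : Fin m → Fin k → ℝ := fun i => if i ∈ s then (fun j => ∑ a, W j a * x i a) else 0
    have hz0 : ∀ i j, 0 ≤ z i j := by
      intro i j
      simp only [z]
      split_ifs
      · exact sum_nonneg fun a _ => mul_nonneg (hW j a) (hx i a)
      · exact le_rfl
    have h1 := hcot m z
    have hS : PW N W (∑ i ∈ s, x i) = N (∑ i, z i) := by
      unfold PW
      congr 1
      funext j
      have hzz : ∀ i, z i j = if i ∈ s then ∑ a, W j a * x i a else 0 := by
        intro i; simp only [z]; split_ifs <;> rfl
      simp only [Finset.sum_apply, hzz, mul_sum]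
      rw [sum_comm, ← sum_filter, filter_mem_eq_inter, univ_inter]
    have hL : ∑ i, N (z i) ^ q = ∑ i ∈ s, PW N W (x i) ^ q := by
      have hzz : ∀ i, N (z i) ^ q = if i ∈ s then PW N W (x i) ^ q else 0 := by
        intro i
        by_cases hi : i ∈ s
        · simp only [z, hi, if_true]; rfl
        · simp only [z, hi, if_false, N_zero hN]
          exact Real.zero_rpow hq0.ne'
      simp only [hzz]
      rw [← sum_filter, filter_mem_eq_inter, univ_inter]
    have hsig : ∀ σ : Fin m → Bool,
        N (∑ i, (if σ i then (1 : ℝ) else -1) • z i) ^ q ≤ N (∑ i, z i) ^ q := by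
      intro σ
      refine Real.rpow_le_rpow (N_nonneg hN _) (N_mono hN hunc _ _ fun j => ?_) hq0.le
      rw [Finset.sum_apply, Finset.sum_apply, abs_of_nonneg (sum_nonneg fun i _ => hz0 i j)]
      refine (abs_sum_le_sum_abs _ _).trans (sum_le_sum fun i _ => ?_)
      simp only [Pi.smul_apply, smul_eq_mul, abs_mul, abs_of_nonneg (hz0 i j)]
      split_ifs <;> simp
    have h2 : 1 / 2 ^ m * ∑ σ : Fin m → Bool, N (∑ i, (if σ i then (1 : ℝ) else -1) • z i) ^ q
        ≤ N (∑ i, z i) ^ q := by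
      have := sum_le_card_nsmul (univ : Finset (Fin m → Bool)) _ _ fun σ _ => hsig σ
      rw [nsmul_eq_mul] at this
      simp only [card_univ, Fintype.card_fun, Fintype.card_bool, Fintype.card_fin] at this
      push_cast at this
      rw [one_div, inv_mul_le_iff₀ (by positivity)]
      exact this
    rw [← hL, hS]
    have h3 := h1.trans h2
    rw [one_div, inv_mul_le_iff₀ (by positivity)] at h3
    exact h3

lemma levels (H : Finset ℝ) (hH : ∀ h ∈ H, 0 < h) :
    ∃ w : ℝ → ℝ, (∀ h, 0 ≤ w h) ∧ (∀ x ∈ H, ∑ h ∈ H.filter (fun h => h ≤ x), w h = x) ∧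
      ∀ b, 0 ≤ b → (∀ h ∈ H, h ≤ b) → ∑ h ∈ H, w h ≤ b := by
  induction H using Finset.induction_on_max with
  | empty => exact ⟨fun _ => 0, by simp, by simp, by simp⟩
  | insert a s ha ih =>
    obtain ⟨w, hw0, hw1, hw2⟩ := ih fun h hh => hH h (mem_insert_of_mem hh)
    have has : a ∉ s := fun h => lt_irrefl _ (ha a h)
    have ha0 : 0 < a := hH a (mem_insert_self _ _)
    have hsum : ∑ h ∈ s, Function.update w a (a - ∑ h ∈ s, w h) h = ∑ h ∈ s, w h := by
      refine sum_congr rfl fun h hh => Function.update_of_ne ?_ _ _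
      rintro rfl; exact has hh
    have htot : ∑ h ∈ insert a s, Function.update w a (a - ∑ h ∈ s, w h) h = a := by
      rw [sum_insert has, hsum, Function.update_self]; ring
    refine ⟨Function.update w a (a - ∑ h ∈ s, w h), ?_, ?_, ?_⟩
    · intro h
      by_cases hh : h = a
      · subst hh
        simp only [Function.update_self]
        have := hw2 h ha0.le fun x hx => (ha x hx).le
        linarith
      · rw [Function.update_of_ne hh]; exact hw0 h
    · intro x hx
      rcases mem_insert.1 hx with rfl | hx
      · rw [filter_true_of_mem, htot]
        intro h hh
        rcases mem_insert.1 hh with rfl | hh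
        · exact le_rfl
        · exact (ha h hh).le
      · rw [filter_insert, if_neg (not_le.2 (ha x hx))]
        conv_rhs => rw [← hw1 x hx]
        refine sum_congr rfl fun h hh => Function.update_of_ne ?_ _ _
        rintro rfl; exact has (mem_filter.1 hh).1
    · intro b _ hb
      rw [htot]
      exact hb a (mem_insert_self _ _)

lemma layer {H : Finset ℝ} (hH : ∀ h ∈ H, 0 < h) {w : ℝ → ℝ}
    (hw1 : ∀ x ∈ H, ∑ h ∈ H.filter (fun h => h ≤ x), w h = x) (x : ℝ) (hx : 0 < x → x ∈ H) :
    ∑ h : H, w h * (if (h : ℝ) ≤ x then 1 else 0) = max x 0 := by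
  rw [sum_coe_sort H (fun h => w h * (if h ≤ x then 1 else 0))]
  simp only [mul_ite, mul_one, mul_zero]
  rw [← sum_filter]
  by_cases h0 : 0 < x
  · rw [hw1 x (hx h0), max_eq_left h0.le]
  · rw [max_eq_right (not_lt.1 h0)]
    rw [filter_eq_empty_iff.2, sum_empty]
    intro h hh hle
    exact h0 ((hH h hh).trans_le hle)

lemma layer_diff {H : Finset ℝ} (hH : ∀ h ∈ H, 0 < h) {w : ℝ → ℝ}
    (hw1 : ∀ x ∈ H, ∑ h ∈ H.filter (fun h => h ≤ x), w h = x) (x y : ℝ) (hx : 0 < x → x ∈ H)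
    (hy : 0 < y → y ∈ H) :
    ∑ h : H, w h * (if ((h : ℝ) ≤ x ∧ ¬ (h : ℝ) ≤ y) ∨ ((h : ℝ) ≤ y ∧ ¬ (h : ℝ) ≤ x) then 1 else 0)
      = |max x 0 - max y 0| := by
  wlog hxy : x ≤ y generalizing x y
  · have := this y x hy hx (le_of_not_ge hxy)
    rw [abs_sub_comm, ← this]
    refine sum_congr rfl fun h _ => ?_
    congr 1
    simp only [or_comm]
  rw [← layer hH hw1 x hx, ← layer hH hw1 y hy, abs_sub_comm, abs_of_nonneg, ← sum_sub_distrib]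
  · refine sum_congr rfl fun h _ => ?_
    rw [← mul_sub]
    congr 1
    by_cases h1 : (h : ℝ) ≤ x
    · simp [h1, h1.trans hxy]
    · simp [h1]
  · rw [layer hH hw1 x hx, layer hH hw1 y hy]
    exact sub_nonneg.2 (max_le_max hxy le_rfl)

lemma edge_ind {n : ℕ} (G : SimpleGraph (Fin n)) [DecidableRel G.Adj] (A : Finset (Fin n))
    (u v : Fin n) (huv : G.Adj u v) :
    s(u, v) ∈ bd G A ↔ (u ∈ A ∧ ¬ v ∈ A) ∨ (v ∈ A ∧ ¬ u ∈ A) := by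
  simp only [bd, mem_filter, SimpleGraph.mem_edgeFinset, SimpleGraph.mem_edgeSet, huv, true_and,
    Sym2.mem_iff]
  constructor
  · rintro ⟨⟨a, rfl | rfl, ha⟩, ⟨b, rfl | rfl, hb⟩⟩ <;> simp_all
  · rintro (⟨h1, h2⟩ | ⟨h1, h2⟩)
    · exact ⟨⟨u, Or.inl rfl, h1⟩, ⟨v, Or.inr rfl, h2⟩⟩
    · exact ⟨⟨v, Or.inr rfl, h1⟩, ⟨u, Or.inl rfl, h2⟩⟩

/-- sign -/
def sg (b : Bool) : ℝ := if b then 1 else -1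

lemma one_case {n d k : ℕ} {q C α ε L : ℝ}
    (hq : 2 ≤ q) (hC : 1 ≤ C) (hd : 3 ≤ d)
    (hα : 0 < α ∧ α ≤ 1) (hε : 0 < ε ∧ ε ≤ 1) (hL : 1 ≤ L)
    (G : SimpleGraph (Fin n)) [DecidableRel G.Adj]
    (hreg : ∀ v, G.degree v = d)
    (hExp : Expan n d G α ε L) {N : (Fin k → ℝ) → ℝ}
    (hN : IsNorm k N) (hunc : OneUnconditional k N) (hcot : HasCotype k N q C)
    (g : Fin n → Fin k → ℝ)
    (hmed : ∀ j, (n : ℝ) / 2 ≤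
      min ((univ.filter fun v => 0 ≤ g v j).card : ℝ)
        ((univ.filter fun v => g v j ≤ 0).card : ℝ)) :
    ∑ v, N (g v) ≤ Bc d q C α ε L * ∑ e ∈ G.edgeFinset, edgeNorm N g e := by
  let H : Finset ℝ := (univ.image fun p : Fin n × Fin k => |g p.1 p.2|).filter fun h => 0 < h
  have hH : ∀ h ∈ H, 0 < h := fun h hh => (mem_filter.1 hh).2
  have hmem : ∀ v j b, 0 < sg b * g v j → sg b * g v j ∈ H := by
    intro v j b hpos
    refine mem_filter.2 ⟨mem_image.2 ⟨(v, j), mem_univ _, ?_⟩, hpos⟩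
    rw [← abs_of_pos hpos, abs_mul]
    have : |sg b| = 1 := by cases b <;> simp [sg]
    rw [this, one_mul]
  obtain ⟨w, hw0, hw1, -⟩ := levels H hH
  let κ := Fin k × Bool × H
  let W : Fin k → κ → ℝ := fun j a => if a.1 = j then w a.2.2 else 0
  have hW : ∀ j a, 0 ≤ W j a := by
    intro j a
    simp only [W]
    split_ifs
    · exact hw0 _
    · exact le_rfl
  have hlat := PW_lat hq hC hN hunc hcot W hW
  let A : κ → Finset (Fin n) := fun a => univ.filter fun v => (a.2.2 : ℝ) ≤ sg a.2.1 * g v a.1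
  have hAc : ∀ a, ((A a).card : ℝ) ≤ n / 2 := by
    rintro ⟨j, b, h⟩
    have hh := hH h h.2
    have h1 := hmed j
    rw [le_min_iff] at h1
    have key : ∀ B : Finset (Fin n), Disjoint (A (j, b, h)) B → (n : ℝ) / 2 ≤ B.card →
        ((A (j, b, h)).card : ℝ) ≤ n / 2 := by
      intro B hdis hB
      have h2 : (A (j, b, h)).card + B.card ≤ n := by
        rw [← card_union_of_disjoint hdis]
        exact (card_le_univ _).trans (by simp)
      have h3 : ((A (j, b, h)).card : ℝ) + B.card ≤ n := by exact_mod_cast h2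
      linarith
    cases b with
    | true =>
      refine key _ (disjoint_left.2 fun v hv hv2 => ?_) h1.2
      simp only [A, mem_filter, mem_univ, true_and, sg, if_true] at hv hv2
      linarith
    | false =>
      refine key _ (disjoint_left.2 fun v hv hv2 => ?_) h1.1
      simp [A, sg] at hv hv2
      linarith
  have hWsum : ∀ (j : Fin k) (F : κ → ℝ), ∑ a, W j a * F a = ∑ b, ∑ h : H, w h * F (j, b, h) := by
    intro j F
    rw [Fintype.sum_prod_type, sum_eq_single j]
    · rw [Fintype.sum_prod_type]
      simp [W]
    · intro i _ hi
      simp [W, hi]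
    · simp
  have hcore := core hd hq hC hα.1 hα.2 hε.2 hL G hreg hExp hlat A hAc (Bc d q C α ε L)
    (fun I => tm_sum hd hq hC hα.1 hα.2 hε.1 hε.2 hL I)
  have hv : ∀ v, N (g v) = PW N W (ind (univ.filter fun a => v ∈ A a)) := by
    intro v
    unfold PW
    rw [hunc]
    congr 1
    funext j
    rw [hWsum]
    simp only [ind, A, mem_filter, mem_univ, true_and]
    simp only [layer hH hw1 _ (hmem v j _)]
    rw [Fintype.sum_bool]
    simp only [sg, if_true, one_mul]
    rcases le_total 0 (g v j) with h | h
    · simp [abs_of_nonneg h, h]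
    · simp [abs_of_nonpos h, h]
  have hB0 : 0 ≤ Bc d q C α ε L := by
    have := tm_sum hd hq hC hα.1 hα.2 hε.1 hε.2 hL 0
    simpa using this
  have he : ∀ e ∈ G.edgeFinset, PW N W (ind (univ.filter fun a => e ∈ bd G (A a))) ≤ edgeNorm N g e := by
    intro e he
    induction e using Sym2.ind with
    | _ u v =>
      have huv : G.Adj u v := by simpa using he
      have : edgeNorm N g s(u, v) = N (g u - g v) := by
        have h1 : edgeNorm N g s(u, v) = min (N (g u - g v)) (N (g v - g u)) := rfl
        rw [h1, ← N_neg hN (g v - g u), neg_sub, min_self]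
      rw [this]
      unfold PW
      refine N_mono hN hunc _ _ fun j => le_of_eq ?_
      rw [hWsum]
      simp only [ind, mem_filter, mem_univ, true_and, edge_ind G _ u v huv]
      simp only [A, mem_filter, mem_univ, true_and]
      simp only [layer_diff hH hw1 _ _ (hmem u j _) (hmem v j _)]
      rw [Fintype.sum_bool]
      simp only [sg, if_true, one_mul, Pi.sub_apply]
      rw [abs_of_nonneg (by positivity)]
      simp only [Bool.false_eq_true, if_false, neg_mul, one_mul]
      rcases le_total 0 (g u j) with h | h <;> rcases le_total 0 (g v j) with h' | h'
      · simp [h, h']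
      · simp only [h, h', max_eq_left, max_eq_right, Left.neg_nonpos_iff, Left.nonneg_neg_iff, sub_zero, zero_sub, neg_neg]
        rw [abs_of_nonneg h, abs_of_nonpos h', abs_of_nonneg (by linarith)]; ring
      · simp only [h, h', max_eq_left, max_eq_right, Left.neg_nonpos_iff, Left.nonneg_neg_iff, sub_zero, zero_sub, abs_neg]
        rw [abs_of_nonneg h', abs_of_nonpos h, abs_of_nonpos (by linarith)]; ring
      · simp only [h, h', max_eq_left, max_eq_right, Left.neg_nonpos_iff, Left.nonneg_neg_iff, sub_zero, abs_zero, zero_add]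
        rw [← abs_neg]; congr 1; ring
  calc _ = _ := sum_congr rfl fun v _ => hv v
    _ ≤ _ := hcore
    _ ≤ _ := mul_le_mul_of_nonneg_left (sum_le_sum he) hB0


lemma young {p a b : ℝ} (hp : 1 < p) (ha : 0 ≤ a) (hb : 0 ≤ b) :
    p * a ^ (p - 1) * b ≤ (p - 1) * a ^ p + b ^ p := by
  rcases ha.eq_or_lt with rfl | ha
  · rw [Real.zero_rpow (by linarith), Real.zero_rpow (by linarith)]
    have := Real.rpow_nonneg hb p
    simpa using this
  · have h := one_add_mul_self_le_rpow_one_add (s := b / a - 1)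
      (by have := div_nonneg hb ha.le; linarith) hp.le
    rw [add_sub_cancel, Real.div_rpow hb ha.le] at h
    have hap : 0 < a ^ p := Real.rpow_pos_of_pos ha p
    rw [le_div_iff₀ hap] at h
    have e : a ^ (p - 1) = a ^ p / a := by rw [Real.rpow_sub ha, Real.rpow_one]
    rw [e]
    have e2 : (1 + p * (b / a - 1)) * a ^ p = p * (a ^ p / a) * b - (p - 1) * a ^ p := by
      field_simp; ring
    linarith

lemma N_powdiff {k : ℕ} {N : (Fin k → ℝ) → ℝ} (hN : IsNorm k N) {p : ℝ} (hp : 1 < p)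
    (x y : Fin k → ℝ) :
    N (N x ^ (p - 1) • x - N y ^ (p - 1) • y) ≤ p * max (N x) (N y) ^ (p - 1) * N (x - y) := by
  wlog hxy : N y ≤ N x generalizing x y
  · have h := this y x (le_of_not_ge hxy)
    rw [max_comm, ← N_neg hN, neg_sub, ← N_neg hN (x - y), neg_sub]
    exact h
  rw [max_eq_left hxy]
  have ha := N_nonneg hN x
  have hb := N_nonneg hN y
  have hD := N_nonneg hN (x - y)
  have htri : N x ≤ N (x - y) + N y := by
    have := hN.2.2 (x - y) y
    rwa [sub_add_cancel] at this
  have hpw : N y ^ (p - 1) ≤ N x ^ (p - 1) := Real.rpow_le_rpow hb hxy (by linarith)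
  have hdec : N x ^ (p - 1) • x - N y ^ (p - 1) • y =
      N x ^ (p - 1) • (x - y) + (N x ^ (p - 1) - N y ^ (p - 1)) • y := by
    rw [smul_sub, sub_smul]; abel
  rw [hdec]
  refine (hN.2.2 _ _).trans ?_
  rw [hN.2.1, hN.2.1, abs_of_nonneg (Real.rpow_nonneg ha _), abs_of_nonneg (by linarith)]
  have hy := young hp ha hb
  have ex : N x ^ p = N x ^ (p - 1) * N x := by
    conv_lhs => rw [show p = (p - 1) + 1 by ring]
    exact Real.rpow_add_one' ha (by linarith)
  have ey : N y ^ p = N y ^ (p - 1) * N y := by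
    conv_lhs => rw [show p = (p - 1) + 1 by ring]
    exact Real.rpow_add_one' hb (by linarith)
  have h3 : (p - 1) * N x ^ (p - 1) * (N x - N y) ≤ (p - 1) * N x ^ (p - 1) * N (x - y) :=
    mul_le_mul_of_nonneg_left (by linarith) (mul_nonneg (by linarith) (Real.rpow_nonneg ha _))
  rw [ex, ey] at hy
  nlinarith

lemma edgeNorm_mk {n k : ℕ} {N : (Fin k → ℝ) → ℝ} (hN : IsNorm k N) (g : Fin n → Fin k → ℝ)
    (u v : Fin n) : edgeNorm N g s(u, v) = N (g u - g v) := by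
  have h1 : edgeNorm N g s(u, v) = min (N (g u - g v)) (N (g v - g u)) := rfl
  rw [h1, ← N_neg hN (g v - g u), neg_sub, min_self]

/-- edge maximum -/
def mE {n : ℕ} (F : Fin n → ℝ) (e : Sym2 (Fin n)) : ℝ :=
  Sym2.lift ⟨fun a b => max (F a) (F b), fun _ _ => max_comm _ _⟩ e

lemma mE_sum {n d : ℕ} (G : SimpleGraph (Fin n)) [DecidableRel G.Adj]
    (hreg : ∀ v, G.degree v = d) (F : Fin n → ℝ) (hF : ∀ v, 0 ≤ F v) {p : ℝ} (hp : 1 < p) :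
    ∑ e ∈ G.edgeFinset, mE F e ^ p ≤ d * ∑ v, F v ^ p := by
  have h1 : ∀ e ∈ G.edgeFinset, mE F e ^ p ≤ ∑ v, if v ∈ e then F v ^ p else 0 := by
    intro e he
    induction e using Sym2.ind with
    | _ u v =>
      have hnn : ∀ w ∈ (univ : Finset (Fin n)), 0 ≤ if w ∈ s(u, v) then F w ^ p else 0 := by
        intro w _
        split_ifs
        · exact Real.rpow_nonneg (hF w) p
        · exact le_rfl
      have hm : mE F s(u, v) = max (F u) (F v) := rfl
      rw [hm]
      rcases le_total (F u) (F v) with h | h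
      · rw [max_eq_right h]
        refine le_trans (le_of_eq ?_) (single_le_sum hnn (mem_univ v))
        simp
      · rw [max_eq_left h]
        refine le_trans (le_of_eq ?_) (single_le_sum hnn (mem_univ u))
        simp
  refine (sum_le_sum h1).trans (le_of_eq ?_)
  rw [sum_comm, mul_sum]
  refine sum_congr rfl fun v _ => ?_
  rw [← sum_filter, sum_const, nsmul_eq_mul, ← SimpleGraph.incidenceFinset_eq_filter,
    SimpleGraph.card_incidenceFinset_eq_degree, hreg]

lemma Bc_le {d : ℕ} {q C α ε L : ℝ} (hq : 2 ≤ q) (hC : 1 ≤ C) (hd : 3 ≤ d)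
    (hα : 0 < α ∧ α ≤ 1) (hε : 0 < ε ∧ ε ≤ 1) (hL : 1 ≤ L) :
    Bc d q C α ε L ≤
      3 * (2 ^ 113 * q ^ 10 * C ^ 2 * ((d : ℝ) ^ 24 * L ^ 8 / (α ^ 14 * ε ^ 18))) / 2 := by
  obtain ⟨ha, ha1⟩ := hα
  obtain ⟨he, he1⟩ := hε
  have hd' : (3 : ℝ) ≤ d := by exact_mod_cast hd
  have e1 : Bc d q C α ε L =
      (55296 * 24) * (q ^ 5) * C * (((d : ℝ) - 1) ^ 6 * L / (α ^ 2 * ε ^ 5)) := by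
    unfold Bc; field_simp
  have e2 : 3 * (2 ^ 113 * q ^ 10 * C ^ 2 * ((d : ℝ) ^ 24 * L ^ 8 / (α ^ 14 * ε ^ 18))) / 2 =
      (3 * 2 ^ 112) * q ^ 10 * C ^ 2 * ((d : ℝ) ^ 24 * L ^ 8 / (α ^ 14 * ε ^ 18)) := by ring
  rw [e1, e2]
  have hd1 : (0 : ℝ) ≤ (d : ℝ) - 1 := by linarith
  have a1 : q ^ 5 ≤ q ^ 10 := pow_le_pow_right₀ (by linarith) (by norm_num)
  have a2 : C ≤ C ^ 2 := le_self_pow₀ hC (by norm_num)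
  have a3 : ((d : ℝ) - 1) ^ 6 ≤ (d : ℝ) ^ 24 :=
    (pow_le_pow_left₀ hd1 (by linarith) 6).trans (pow_le_pow_right₀ (by linarith) (by norm_num))
  have a4 : L ≤ L ^ 8 := le_self_pow₀ hL (by norm_num)
  have a5 : α ^ 14 ≤ α ^ 2 := pow_le_pow_of_le_one ha.le ha1 (by norm_num)
  have a6 : ε ^ 18 ≤ ε ^ 5 := pow_le_pow_of_le_one he.le he1 (by norm_num)
  have a7 : (55296 * 24 : ℝ) ≤ 3 * 2 ^ 112 := by norm_num
  have h0 : (0 : ℝ) ≤ ((d : ℝ) - 1) ^ 6 * L / (α ^ 2 * ε ^ 5) := by positivity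
  have h1 : ((d : ℝ) - 1) ^ 6 * L / (α ^ 2 * ε ^ 5) ≤ (d : ℝ) ^ 24 * L ^ 8 / (α ^ 14 * ε ^ 18) := by
    refine div_le_div₀ (by positivity) ?_ (by positivity) ?_
    · exact mul_le_mul a3 a4 (by linarith) (by positivity)
    · exact mul_le_mul a5 a6 (by positivity) (by positivity)
  refine mul_le_mul ?_ h1 h0 (by positivity)
  refine mul_le_mul ?_ a2 (by linarith) (by positivity)
  exact mul_le_mul a7 a1 (by positivity) (by norm_num)

lemma p_case {n d k : ℕ} {q C α ε L p : ℝ}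
    (hq : 2 ≤ q) (hC : 1 ≤ C) (hd : 3 ≤ d)
    (hα : 0 < α ∧ α ≤ 1) (hε : 0 < ε ∧ ε ≤ 1) (hL : 1 ≤ L) (hp : 1 < p)
    (G : SimpleGraph (Fin n)) [DecidableRel G.Adj]
    (hreg : ∀ v, G.degree v = d)
    (hExp : Expan n d G α ε L) {N : (Fin k → ℝ) → ℝ}
    (hN : IsNorm k N) (hunc : OneUnconditional k N) (hcot : HasCotype k N q C)
    (f : Fin n → Fin k → ℝ)
    (hmed : ∀ j, (n : ℝ) / 2 ≤
      min ((univ.filter fun v => 0 ≤ f v j).card : ℝ)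
        ((univ.filter fun v => f v j ≤ 0).card : ℝ)) :
    ∑ v, N (f v) ^ p ≤
      (Bc d q C α ε L * p) ^ p * (d : ℝ) ^ (p - 1) * ∑ e ∈ G.edgeFinset, edgeNorm N f e ^ p := by
  have hB0 : 0 ≤ Bc d q C α ε L := by
    have := tm_sum hd hq hC hα.1 hα.2 hε.1 hε.2 hL 0
    simpa using this
  have hF : ∀ v, 0 ≤ N (f v) := fun v => N_nonneg hN _
  have hen : ∀ e, 0 ≤ edgeNorm N f e := by
    intro e
    induction e using Sym2.ind with
    | _ u v => rw [edgeNorm_mk hN]; exact N_nonneg hN _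
  have hmE : ∀ e, 0 ≤ mE (fun v => N (f v)) e := by
    intro e
    induction e using Sym2.ind with
    | _ u v => exact (hF u).trans (le_max_left _ _)
  set B := Bc d q C α ε L with hB
  have hone := one_case hq hC hd hα hε hL G hreg hExp hN hunc hcot
    (fun v => N (f v) ^ (p - 1) • f v) (by
      intro j
      refine (hmed j).trans (min_le_min ?_ ?_)
      · refine Nat.cast_le.2 (card_le_card fun v hv => ?_)
        simp only [mem_filter, mem_univ, true_and, Pi.smul_apply, smul_eq_mul] at hv ⊢
        exact mul_nonneg (Real.rpow_nonneg (hF v) _) hv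
      · refine Nat.cast_le.2 (card_le_card fun v hv => ?_)
        simp only [mem_filter, mem_univ, true_and, Pi.smul_apply, smul_eq_mul] at hv ⊢
        exact mul_nonpos_of_nonneg_of_nonpos (Real.rpow_nonneg (hF v) _) hv)
  rw [← hB] at hone
  have hlhs : ∀ v, N (N (f v) ^ (p - 1) • f v) = N (f v) ^ p := by
    intro v
    rw [hN.2.1, abs_of_nonneg (Real.rpow_nonneg (hF v) _)]
    conv_rhs => rw [show p = (p - 1) + 1 by ring]
    exact (Real.rpow_add_one' (hF v) (by linarith)).symm
  simp only [hlhs] at hone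
  set X := ∑ v, N (f v) ^ p with hX
  set Y := ∑ e ∈ G.edgeFinset, edgeNorm N f e ^ p with hY
  have hX0 : 0 ≤ X := sum_nonneg fun v _ => Real.rpow_nonneg (hF v) _
  have hY0 : 0 ≤ Y := sum_nonneg fun v _ => Real.rpow_nonneg (hen v) _
  have hpq : p.HolderConjugate (p / (p - 1)) := Real.HolderConjugate.conjExponent hp
  have hH := Real.inner_le_Lp_mul_Lq_of_nonneg G.edgeFinset hpq
    (f := fun e => edgeNorm N f e) (g := fun e => mE (fun v => N (f v)) e ^ (p - 1))
    (fun e _ => hen e) (fun e _ => Real.rpow_nonneg (hmE e) _)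
  have hpow : ∀ e, (mE (fun v => N (f v)) e ^ (p - 1)) ^ (p / (p - 1)) =
      mE (fun v => N (f v)) e ^ p := by
    intro e
    rw [← Real.rpow_mul (hmE e)]
    congr 1
    have : p - 1 ≠ 0 := by linarith
    field_simp
  simp only [hpow] at hH
  have hm := mE_sum G hreg (fun v => N (f v)) hF hp
  have hedge : ∑ e ∈ G.edgeFinset, edgeNorm N (fun v => N (f v) ^ (p - 1) • f v) e ≤
      p * ∑ e ∈ G.edgeFinset, edgeNorm N f e * mE (fun v => N (f v)) e ^ (p - 1) := by
    rw [mul_sum]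
    refine sum_le_sum fun e _ => ?_
    induction e using Sym2.ind with
    | _ u v =>
      rw [edgeNorm_mk hN, edgeNorm_mk hN]
      refine (N_powdiff hN hp (f u) (f v)).trans (le_of_eq ?_)
      have : mE (fun v => N (f v)) s(u, v) = max (N (f u)) (N (f v)) := rfl
      rw [this]; ring
  have hms0 : 0 ≤ ∑ e ∈ G.edgeFinset, mE (fun v => N (f v)) e ^ p :=
    sum_nonneg fun e _ => Real.rpow_nonneg (hmE e) _
  have hr : 1 / (p / (p - 1)) = (p - 1) / p := by rw [one_div_div]
  have hd0 : (0 : ℝ) ≤ d := Nat.cast_nonneg d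
  have hmain : X ≤ B * p * (Y ^ (1 / p) * (d * X) ^ ((p - 1) / p)) := by
    calc X ≤ B * (p * (Y ^ (1 / p) *
          (∑ e ∈ G.edgeFinset, mE (fun v => N (f v)) e ^ p) ^ (1 / (p / (p - 1))))) :=
          hone.trans (mul_le_mul_of_nonneg_left (hedge.trans
            (mul_le_mul_of_nonneg_left hH (by linarith))) hB0)
      _ ≤ B * (p * (Y ^ (1 / p) * (d * X) ^ ((p - 1) / p))) := by
          rw [hr]
          have := Real.rpow_le_rpow (z := (p - 1) / p) hms0 hm (div_nonneg (by linarith) (by linarith))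
          gcongr
      _ = _ := by ring
  rcases hX0.eq_or_lt with h0 | hXp
  · rw [← h0]
    have : 0 ≤ B * p := mul_nonneg hB0 (by linarith)
    positivity
  have hp0 : p ≠ 0 := by linarith
  have hp1 : 0 ≤ p := by linarith
  have hBp : 0 ≤ B * p := mul_nonneg hB0 hp1
  have h5 := Real.rpow_le_rpow hX0 hmain hp1
  rw [Real.mul_rpow (x := B * p) hBp (by positivity),
    Real.mul_rpow (x := Y ^ (1 / p)) (by positivity) (by positivity),
    ← Real.rpow_mul hY0, ← Real.rpow_mul (by positivity), one_div_mul_cancel hp0,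
    div_mul_cancel₀ _ hp0, Real.rpow_one, Real.mul_rpow hd0 hX0] at h5
  have ex : X ^ p = X ^ (p - 1) * X := by
    conv_lhs => rw [show p = (p - 1) + 1 by ring]
    exact Real.rpow_add_one' hX0 (by linarith)
  have hXq : 0 < X ^ (p - 1) := Real.rpow_pos_of_pos hXp _
  rw [ex] at h5
  refine le_of_mul_le_mul_left (h5.trans (le_of_eq ?_)) hXq
  ring

end Pf

/-- Corollary 3.3, inequality (3.5): the `L^p` Poincaré-type inequality for maps having `0` as
an empirical median. -/
theorem stmt_6 {n d k : ℕ} (q C α ε L p : ℝ)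
    (hq : 2 ≤ q) (hC : 1 ≤ C) (hd : 3 ≤ d)
    (hα : 0 < α ∧ α ≤ 1) (hε : 0 < ε ∧ ε ≤ 1) (hL : 1 ≤ L) (hp : 1 < p)
    (G : SimpleGraph (Fin n)) [DecidableRel G.Adj]
    (hreg : ∀ v, G.degree v = d)
    (hExp : Expan n d G α ε L)
    (hk : 1 ≤ k) (N : (Fin k → ℝ) → ℝ)
    (hN : IsNorm k N) (hunc : OneUnconditional k N) (hcot : HasCotype k N q C)
    (f : Fin n → Fin k → ℝ)
    (hnc : ∃ v w, f v ≠ f w)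
    (hmed : ∀ j, (n : ℝ) / 2 ≤
      min ((univ.filter fun v => 0 ≤ f v j).card : ℝ)
        ((univ.filter fun v => f v j ≤ 0).card : ℝ)) :
    ∑ v, N (f v) ^ p ≤
      (3 * (2 ^ 113 * q ^ 10 * C ^ 2 * ((d : ℝ) ^ 24 * L ^ 8 / (α ^ 14 * ε ^ 18))) / 2) ^ p *
          (d : ℝ) ^ (p - 1) * max 2 p ^ p *
        ∑ e ∈ G.edgeFinset, edgeNorm N f e ^ p := by
  have h := Pf.p_case hq hC hd hα hε hL hp G hreg hExp hN hunc hcot f hmed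
  refine h.trans ?_
  have hB0 : 0 ≤ Pf.Bc d q C α ε L := by
    have := Pf.tm_sum hd hq hC hα.1 hα.2 hε.1 hε.2 hL 0
    simpa using this
  have hBl := Pf.Bc_le hq hC hd hα hε hL
  have hp0 : 0 ≤ p := by linarith
  have hY0 : 0 ≤ ∑ e ∈ G.edgeFinset, edgeNorm N f e ^ p := by
    refine sum_nonneg fun e _ => Real.rpow_nonneg ?_ _
    induction e using Sym2.ind with
    | _ u v => rw [Pf.edgeNorm_mk hN]; exact Pf.N_nonneg hN _
  refine mul_le_mul_of_nonneg_right ?_ hY0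
  have hm : (0 : ℝ) ≤ max 2 p := le_max_of_le_right hp0
  rw [mul_right_comm, ← Real.mul_rpow (hB0.trans hBl) hm]
  refine mul_le_mul_of_nonneg_right ?_ (Real.rpow_nonneg (Nat.cast_nonneg d) _)
  exact Real.rpow_le_rpow (mul_nonneg hB0 hp0)
    (mul_le_mul hBl (le_max_right _ _) hp0 (hB0.trans hBl)) hp0
end

section
/- Let k and m be positive integers, let δ > 0, let q ≥ 2, and let C ≥ 1. Let x ∈ ℝ^k have all coordinates nonnegative, and let J_1,…,J_m be subsets of [k] such that for every j ∈ [k], |{i ∈ [m] : j ∈ J_i}| ≤ δm. Let ‖·‖_X be a 1-unconditional norm on ℝ^k such that ‖P_{J_i}(x)‖_X ≥ 1 for every i ∈ [m], and assume that the collection of vectors {P_J(x) : J ⊆ [k]} has restricted cotype q with constant C with respect to ‖·‖_X. Then ‖x‖_X^q ≥ (1/C^q) · (1/δ) · (1/2)^{2q+5}. -/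
open Finset

attribute [local instance] Classical.propDecidable

theorem aux_nonneg {k : ℕ} {N : (Fin k → ℝ) → ℝ} (hN : IsNorm k N) (x : Fin k → ℝ) : 0 ≤ N x := by
  obtain ⟨h0, hs, ht⟩ := hN
  have h1 := ht x ((-1 : ℝ) • x)
  have h2 : x + (-1 : ℝ) • x = 0 := by ext; simp
  rw [h2, (h0 0).2 rfl, hs] at h1
  norm_num at h1
  linarith

theorem aux_update {k : ℕ} {N : (Fin k → ℝ) → ℝ} (hN : IsNorm k N) (hunc : OneUnconditional k N)
    (z : Fin k → ℝ) (j : Fin k) (a : ℝ) (h : |a| ≤ |z j|) : N (Function.update z j a) ≤ N z := by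
  obtain ⟨h0, hs, ht⟩ := hN
  obtain ⟨c, hc, hca⟩ : ∃ c : ℝ, |c| ≤ 1 ∧ a = c * z j := by
    by_cases hz : z j = 0
    · refine ⟨0, by simp, ?_⟩
      rw [hz, abs_zero] at h
      simpa using h
    · refine ⟨a / z j, ?_, by field_simp⟩
      rw [abs_div]
      exact div_le_one_of_le₀ h (abs_nonneg _)
  have hflip : N (Function.update z j (-z j)) = N z := by
    rw [hunc, hunc z]
    congr 1
    ext i
    by_cases hi : i = j
    · subst hi; simp
    · simp [hi]
  have hdec : Function.update z j a
      = ((1 + c) / 2) • z + ((1 - c) / 2) • Function.update z j (-z j) := by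
    ext i
    by_cases hi : i = j
    · subst hi; simp [hca]; ring
    · simp [hi]; ring
  rw [abs_le] at hc
  rw [hdec]
  refine (ht _ _).trans ?_
  rw [hs, hs, hflip, abs_of_nonneg (by linarith), abs_of_nonneg (by linarith)]
  apply le_of_eq; ring

theorem aux_mono {k : ℕ} {N : (Fin k → ℝ) → ℝ} (hN : IsNorm k N) (hunc : OneUnconditional k N)
    (y z : Fin k → ℝ) (h : ∀ j, |y j| ≤ |z j|) : N y ≤ N z := by
  have key : ∀ S : Finset (Fin k), N (S.piecewise y z) ≤ N z := by
    intro S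
    induction S using Finset.induction_on with
    | empty => simp
    | insert j S hj ih =>
      rw [Finset.piecewise_insert]
      refine (aux_update hN hunc _ _ _ ?_).trans ih
      rw [Finset.piecewise_eq_of_notMem _ _ _ hj]
      exact h j
  have := key univ
  simpa using this

theorem aux_disj {k : ℕ} {q C : ℝ} (hq : 2 ≤ q)
    (x : Fin k → ℝ) (N : (Fin k → ℝ) → ℝ) (hN : IsNorm k N) (hunc : OneUnconditional k N)
    (hrc : RestrictedCotype k N q C {y | ∃ J' : Finset (Fin k), y = proj J' x})
    (s : ℕ) (A : Fin s → Finset (Fin k)) (hA : ∀ t u j, j ∈ A t → j ∈ A u → t = u) :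
    1 / C ^ q * ∑ t, N (proj (A t) x) ^ q ≤ N x ^ q := by
  have hN0 : N 0 = 0 := (hN.1 0).2 rfl
  set T : Finset (Fin s) := univ.filter fun t => proj (A t) x ≠ 0 with hT
  have hsum : ∑ t, N (proj (A t) x) ^ q = ∑ t ∈ T, N (proj (A t) x) ^ q := by
    symm
    apply Finset.sum_subset (Finset.subset_univ _)
    intro t _ ht
    have : proj (A t) x = 0 := by simpa [hT] using ht
    rw [this, hN0, Real.zero_rpow (by linarith)]
  rw [hsum]
  rcases Nat.eq_zero_or_pos T.card with h0 | hpos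
  · rw [Finset.card_eq_zero.1 h0]
    simpa using Real.rpow_nonneg (aux_nonneg hN x) q
  · let e := T.equivFin.symm
    have hinj : Function.Injective (fun i => proj (A (e i)) x) := by
      intro i i' hii
      have hne : proj (A (e i)) x ≠ 0 := (Finset.mem_filter.1 (e i).2).2
      obtain ⟨j, hj⟩ := Function.ne_iff.1 hne
      have h1 : j ∈ A (e i) := by
        by_contra hc; simp [proj, hc] at hj
      have h2 : j ∈ A (e i') := by
        have hj' : proj (A (e i')) x j ≠ 0 := by
          have := congrFun hii j
          simp only at this
          rw [← this]; exact hj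
        by_contra hc; simp [proj, hc] at hj'
      exact e.injective (Subtype.ext (hA _ _ j h1 h2))
    have := hrc T.card hpos (fun i => proj (A (e i)) x) hinj (fun i => ⟨_, rfl⟩)
    have hs2 : ∑ i, N (proj (A (e i)) x) ^ q = ∑ t ∈ T, N (proj (A t) x) ^ q := by
      rw [Equiv.sum_comp e (fun t : T => N (proj (A t) x) ^ q)]
      exact Finset.sum_coe_sort T (fun t => N (proj (A t) x) ^ q)
    rw [hs2] at this
    refine this.trans ?_
    have hb : ∀ σ : Fin T.card → Bool,
        N (∑ i, (if σ i then (1 : ℝ) else -1) • proj (A (e i)) x) ^ q ≤ N x ^ q := by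
      intro σ
      apply Real.rpow_le_rpow (aux_nonneg hN _) _ (by linarith)
      apply aux_mono hN hunc
      intro j
      rw [Finset.sum_apply]
      by_cases hj : ∃ i, j ∈ A (e i)
      · obtain ⟨i, hi⟩ := hj
        rw [Finset.sum_eq_single i]
        · simp only [proj, Pi.smul_apply, hi, if_true, smul_eq_mul, abs_mul]
          split_ifs <;> simp
        · intro b _ hb
          have : j ∉ A (e b) := fun hc =>
            hb (e.injective (Subtype.ext (hA _ _ j hc hi)))
          simp [proj, this]
        · simp
      · push Not at hj
        rw [Finset.sum_eq_zero]
        · simp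
        · intro i _
          simp [proj, hj i]
    calc _ ≤ 1 / 2 ^ T.card * ∑ σ : Fin T.card → Bool, N x ^ q := by
            exact mul_le_mul_of_nonneg_left (Finset.sum_le_sum fun σ _ => hb σ) (by positivity)
      _ = N x ^ q := by
        simp

/-- The disjoint pieces. -/
def auxA {k m s : ℕ} (J : Fin m → Finset (Fin k)) (f : Fin s → Fin m) (t : Fin s) :
    Finset (Fin k) :=
  univ.filter fun j => j ∈ J (f t) ∧ ∀ u, u ≠ t → j ∉ J (f u)

theorem aux_count {k m r : ℕ} (hm : 0 < m) (δ : ℝ)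
    (hr : r * δ ≤ 1 / 2) (J : Fin m → Finset (Fin k))
    (hJ : ∀ j : Fin k, ((univ.filter fun i => j ∈ J i).card : ℝ) ≤ δ * m)
    (t : Fin (r + 1)) (i : Fin m) (j : Fin k) (hj : j ∈ J i) :
    (m : ℝ) ^ r / 2 ≤ ((univ.filter fun f : Fin (r + 1) → Fin m =>
      f t = i ∧ j ∈ auxA J f t).card : ℝ) := by
  have hm' : (0 : ℝ) < m := by exact_mod_cast hm
  set B : Finset (Fin m) := univ.filter fun i => ¬ j ∈ J i with hB
  have heq : (univ.filter fun f : Fin (r + 1) → Fin m => f t = i ∧ j ∈ auxA J f t)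
      = Fintype.piFinset (fun u => if u = t then {i} else B) := by
    ext f
    simp only [mem_filter, mem_univ, true_and, Fintype.mem_piFinset, auxA]
    constructor
    · rintro ⟨h1, h2, h3⟩ u
      by_cases hu : u = t
      · subst hu; simp [h1]
      · simp [hu, hB, h3 u hu]
    · intro h
      have h1 : f t = i := by simpa using h t
      refine ⟨h1, h1 ▸ hj, ?_⟩
      intro u hu
      simpa [hu, hB] using h u
  have hcard : (Fintype.piFinset (fun u : Fin (r+1) => if u = t then {i} else B)).card
      = B.card ^ r := by
    rw [Fintype.card_piFinset, ← Finset.mul_prod_erase univ _ (mem_univ t)]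
    rw [Finset.prod_congr rfl (g := fun _ => B.card)]
    · simp
    · intro u hu
      simp [Finset.ne_of_mem_erase hu]
  rw [heq, hcard]
  have hBc : (univ.filter fun i => j ∈ J i).card + B.card = m := by
    have := Finset.card_filter_add_card_filter_not (s := (univ : Finset (Fin m)))
      (fun i => j ∈ J i)
    simpa [hB] using this
  have hBc' : ((univ.filter fun i => j ∈ J i).card : ℝ) + B.card = m := by exact_mod_cast hBc
  set d : ℝ := ((univ.filter fun i => j ∈ J i).card : ℝ) with hd
  have hd0 : 0 ≤ d := by positivity
  have hB0 : (0 : ℝ) ≤ B.card := by positivity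
  have hdj := hJ j
  have hrho : d / m ≤ δ := by rw [div_le_iff₀ hm']; exact hdj
  have hrho1 : d / m ≤ 1 := by rw [div_le_iff₀ hm']; linarith
  have hbern := one_add_mul_le_pow (a := -(d / m)) (by linarith) r
  have hBe : (B.card : ℝ) = m * (1 + -(d / m)) := by field_simp; linarith
  push_cast
  rw [hBe, mul_pow, div_eq_mul_inv]
  gcongr
  refine le_trans ?_ hbern
  have : (r : ℝ) * (d / m) ≤ r * δ := by gcongr
  linarith

theorem aux_sum {k : ℕ} {N : (Fin k → ℝ) → ℝ} (hN : IsNorm k N) {ι : Type*} (S : Finset ι)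
    (g : ι → Fin k → ℝ) : N (∑ a ∈ S, g a) ≤ ∑ a ∈ S, N (g a) := by
  classical
  induction S using Finset.induction_on with
  | empty => simp [(hN.1 0).2 rfl]
  | insert a S ha ih =>
    rw [Finset.sum_insert ha, Finset.sum_insert ha]
    exact (hN.2.2 _ _).trans (by linarith)

theorem aux_avg {k m r : ℕ} (hm : 0 < m) (δ : ℝ)
    (hr : r * δ ≤ 1 / 2) (J : Fin m → Finset (Fin k))
    (hJ : ∀ j : Fin k, ((univ.filter fun i => j ∈ J i).card : ℝ) ≤ δ * m)
    (x : Fin k → ℝ) (hx : ∀ j, 0 ≤ x j)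
    (N : (Fin k → ℝ) → ℝ) (hN : IsNorm k N) (hunc : OneUnconditional k N)
    (hlow : ∀ i, 1 ≤ N (proj (J i) x)) (t : Fin (r + 1)) :
    (m : ℝ) ^ (r + 1) / 2 ≤ ∑ f : Fin (r + 1) → Fin m, N (proj (auxA J f t) x) := by
  rw [← Finset.sum_fiberwise univ (fun f : Fin (r + 1) → Fin m => f t)]
  have h : ∀ i : Fin m, (m : ℝ) ^ r / 2 ≤
      ∑ f ∈ univ.filter (fun f : Fin (r + 1) → Fin m => f t = i), N (proj (auxA J f t) x) := by
    intro i
    refine le_trans ?_ (aux_sum hN _ _)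
    have h1 : N (((m : ℝ) ^ r / 2) • proj (J i) x) ≤
        N (∑ f ∈ univ.filter (fun f : Fin (r + 1) → Fin m => f t = i), proj (auxA J f t) x) := by
      apply aux_mono hN hunc
      intro j
      rw [Finset.sum_apply]
      by_cases hj : j ∈ J i
      · have hc := aux_count hm δ hr J hJ t i j hj
        have he : ∑ f ∈ univ.filter (fun f : Fin (r + 1) → Fin m => f t = i),
            proj (auxA J f t) x j = ((univ.filter fun f : Fin (r + 1) → Fin m =>
              f t = i ∧ j ∈ auxA J f t).card : ℝ) * x j := by
          simp only [proj]
          rw [← Finset.sum_filter, Finset.filter_filter, Finset.sum_const, nsmul_eq_mul]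
        rw [he]
        simp only [proj, Pi.smul_apply, hj, if_true, smul_eq_mul]
        have := hx j
        rw [abs_of_nonneg (by positivity), abs_of_nonneg (by positivity)]
        gcongr
      · simp [proj, hj]
    rw [hN.2.1, abs_of_nonneg (by positivity)] at h1
    refine le_trans ?_ h1
    exact le_mul_of_one_le_right (by positivity) (hlow i)
  calc (m : ℝ) ^ (r + 1) / 2 = ∑ i : Fin m, (m : ℝ) ^ r / 2 := by simp; ring
    _ ≤ _ := Finset.sum_le_sum fun i _ => h i

/-- Proposition 2.2: restricted cotype and almost disjoint supports force a large norm. -/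
theorem stmt_7 {k m : ℕ} (hk : 0 < k) (hm : 0 < m) (δ q C : ℝ)
    (hδ : 0 < δ) (hq : 2 ≤ q) (hC : 1 ≤ C)
    (x : Fin k → ℝ) (hx : ∀ j, 0 ≤ x j)
    (J : Fin m → Finset (Fin k))
    (hJ : ∀ j : Fin k, ((univ.filter fun i => j ∈ J i).card : ℝ) ≤ δ * m)
    (N : (Fin k → ℝ) → ℝ) (hN : IsNorm k N) (hunc : OneUnconditional k N)
    (hlow : ∀ i, 1 ≤ N (proj (J i) x))
    (hrc : RestrictedCotype k N q C {y | ∃ J' : Finset (Fin k), y = proj J' x}) :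
    1 / C ^ q * (1 / δ) * (1 / 2 : ℝ) ^ (2 * q + 5) ≤ N x ^ q := by
  have hm' : (0 : ℝ) < m := by exact_mod_cast hm
  set r : ℕ := ⌊1 / (2 * δ)⌋₊ with hrdef
  have hr : r * δ ≤ 1 / 2 := by
    have h1 : (r : ℝ) ≤ 1 / (2 * δ) := Nat.floor_le (by positivity)
    calc (r : ℝ) * δ ≤ 1 / (2 * δ) * δ := by gcongr
      _ = 1 / 2 := by field_simp
  have hs : 1 / (2 * δ) < (r : ℝ) + 1 := Nat.lt_floor_add_one _
  have havg := aux_avg hm δ hr J hJ x hx N hN hunc hlow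
  have hex : ∃ f : Fin (r + 1) → Fin m,
      ((r : ℝ) + 1) / 2 ≤ ∑ t, N (proj (auxA J f t) x) := by
    have hne : (univ : Finset (Fin (r + 1) → Fin m)).Nonempty := ⟨fun _ => ⟨0, hm⟩, mem_univ _⟩
    have := Finset.exists_le_of_sum_le (f := fun _ : Fin (r + 1) → Fin m => ((r : ℝ) + 1) / 2)
      (g := fun f => ∑ t, N (proj (auxA J f t) x)) hne (by
        rw [Finset.sum_comm]
        calc _ = ∑ t : Fin (r + 1), (m : ℝ) ^ (r + 1) / 2 := by simp; ring
          _ ≤ _ := Finset.sum_le_sum fun t _ => havg t)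
    obtain ⟨f, _, hf⟩ := this
    exact ⟨f, hf⟩
  obtain ⟨f, hf⟩ := hex
  have hd := aux_disj hq x N hN hunc hrc (r + 1) (auxA J f) (by
    intro t u j ht hu
    by_contra hne
    simp only [auxA, mem_filter, mem_univ, true_and] at ht hu
    exact hu.2 t hne ht.1)
  have hr1 : (0 : ℝ) < (r : ℝ) + 1 := by positivity
  have hpm := Real.rpow_arith_mean_le_arith_mean_rpow (univ : Finset (Fin (r + 1)))
    (fun _ => 1 / ((r : ℝ) + 1)) (fun t => N (proj (auxA J f t) x))
    (fun _ _ => by positivity) (by simp; field_simp) (fun t _ => aux_nonneg hN _)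
    (p := q) (by linarith)
  rw [← Finset.mul_sum, ← Finset.mul_sum] at hpm
  have h2 : (1 / 2 : ℝ) ^ q ≤ 1 / ((r : ℝ) + 1) * ∑ t, N (proj (auxA J f t) x) ^ q := by
    refine le_trans (Real.rpow_le_rpow (by norm_num) ?_ (by linarith)) hpm
    rw [one_div_mul_eq_div, le_div_iff₀ hr1]
    linarith
  rw [one_div_mul_eq_div, le_div_iff₀ hr1] at h2
  have hCq : 0 < C ^ q := Real.rpow_pos_of_pos (by linarith) q
  refine le_trans ?_ hd
  rw [mul_assoc]
  gcongr
  refine le_trans ?_ h2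
  have h3 : (1 / 2 : ℝ) ^ (2 * q + 5) ≤ (1 / 2) ^ (q + 1) :=
    Real.rpow_le_rpow_of_exponent_ge (by norm_num) (by norm_num) (by linarith)
  rw [Real.rpow_add_one (by norm_num)] at h3
  have h4 : (0 : ℝ) < (1 / 2) ^ q := by positivity
  calc 1 / δ * (1 / 2 : ℝ) ^ (2 * q + 5) ≤ 1 / δ * ((1 / 2) ^ q * (1 / 2)) := by gcongr
    _ = (1 / 2) ^ q * (1 / (2 * δ)) := by field_simp
    _ ≤ _ := by gcongr
end

section
/- Let d ≥ 3 be an integer, let α, ε ∈ (0,1], L ≥ 1, and let G be a d-regular simple graph on [n] satisfying the long-range expansion property Expan(α,ε,L). Let k ≥ 1 and let f : [n] → {−1,0,1}^k satisfy min{|{v ∈ [n] : f(v)_j ≥ 0}|, |{v ∈ [n] : f(v)_j ≤ 0}|} ≥ n/2 for every j ∈ [k]. Let j ∈ [k] and let S ⊆ [n] be a nonempty set of vertices such that f(v)_j = f(w)_j ≠ 0 for all v,w ∈ S. Then there exists a positive integer ℓ_0 ≤ min{ℓ ≥ 1 : α(d−1)^ℓ|S| ≥ 3n/4} such that |E(S,j;ℓ_0)|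 ≥ (α·a_{ℓ_0}/6)·(d−1)^{ℓ_0−1}·|S|. -/
open Finset

attribute [local instance] Classical.propDecidable

lemma vsd_adj {n : ℕ} (G : SimpleGraph (Fin n)) (S : Finset (Fin n)) {a b : Fin n}
    (h : G.Adj a b) : vertexSetDist G a S ≤ vertexSetDist G b S + 1 := by
  rcases S.eq_empty_or_nonempty with rfl | hS
  · simp [vertexSetDist]
  obtain ⟨x, hx, hxe⟩ := Finset.exists_mem_eq_inf S hS (fun w => G.edist b w)
  unfold vertexSetDist
  rw [hxe]
  refine (Finset.inf_le hx).trans ?_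
  calc G.edist a x ≤ G.edist a b + G.edist b x := G.edist_triangle
    _ = G.edist b x + 1 := by rw [SimpleGraph.edist_eq_one_iff_adj.2 h, add_comm]

lemma vsd_parent {n : ℕ} (G : SimpleGraph (Fin n)) (S : Finset (Fin n)) {v : Fin n} {t : ℕ}
    (h : vertexSetDist G v S = ((t + 1 : ℕ) : ℕ∞)) :
    ∃ w, G.Adj v w ∧ vertexSetDist G w S = (t : ℕ∞) := by
  rcases S.eq_empty_or_nonempty with rfl | hS
  · simp [vertexSetDist] at h
    exact absurd h.symm (by exact_mod_cast ENat.coe_ne_top (t+1))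
  obtain ⟨x, hx, hxe⟩ := Finset.exists_mem_eq_inf S hS (fun w => G.edist v w)
  have h1 : G.edist v x = ((t + 1 : ℕ) : ℕ∞) := by
    rw [← h]; exact hxe.symm
  obtain ⟨p, hp⟩ := SimpleGraph.exists_walk_of_edist_eq_coe h1
  cases p with
  | nil => simp at hp
  | @cons _ w _ hadj p =>
    refine ⟨w, hadj, le_antisymm ?_ ?_⟩
    · have : G.edist w x ≤ (t : ℕ∞) := by
        refine (SimpleGraph.Walk.edist_le p).trans ?_
        simp at hp
        exact_mod_cast hp.le
      exact (Finset.inf_le hx).trans this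
    · have := vsd_adj G S hadj
      rw [h] at this
      push_cast at this
      exact (ENat.add_le_add_iff_right (by simp)).1 this

lemma esd_le {n : ℕ} (G : SimpleGraph (Fin n)) (S : Finset (Fin n)) (a b : Fin n) :
    edgeSetDist G s(a, b) S ≤ vertexSetDist G a S := by
  unfold edgeSetDist vertexSetDist
  refine Finset.le_inf fun x hx => (Finset.inf_le hx).trans ?_
  simp [edgeDist, SimpleGraph.edist_comm]

lemma vsd_zero {n : ℕ} (G : SimpleGraph (Fin n)) (S : Finset (Fin n)) {v : Fin n}
    (h : vertexSetDist G v S = 0) : v ∈ S := by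
  rcases S.eq_empty_or_nonempty with rfl | hS
  · simp [vertexSetDist] at h
  obtain ⟨x, hx, hxe⟩ := Finset.exists_mem_eq_inf S hS (fun w => G.edist v w)
  have h1 : G.edist v x = 0 := by rw [← h]; exact hxe.symm
  rw [SimpleGraph.edist_eq_zero_iff] at h1
  exact h1 ▸ hx

lemma aseq_sum_le (m : ℕ) : ∑ i ∈ Finset.range m, aseq (i + 1) ≤ 1 := by
  have h := hasSum_zeta_two
  have h1 := sum_le_hasSum (Finset.range (m + 1)) (fun i _ => by positivity) h
  rw [Finset.sum_range_succ'] at h1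
  simp only [aseq, ← Finset.mul_sum]
  have hp : (0 : ℝ) < Real.pi ^ 2 := by positivity
  simp at h1
  simp
  calc _ ≤ 6 / Real.pi ^ 2 * (Real.pi ^ 2 / 6) := by gcongr
    _ = 1 := by field_simp

/-- Bad vertices at level `t`. -/
noncomputable def badLevel {n k : ℕ} (G : SimpleGraph (Fin n)) (f : Fin n → Fin k → ℝ) (j : Fin k)
    (S : Finset (Fin n)) (s : ℝ) (t : ℕ) : Finset (Fin n) :=
  univ.filter fun v => vertexSetDist G v S = (t : ℕ∞) ∧ f v j ≠ s

lemma bad_step {n d k : ℕ} (G : SimpleGraph (Fin n)) [DecidableRel G.Adj]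
    (hreg : ∀ v, G.degree v = d) (f : Fin n → Fin k → ℝ) (j : Fin k)
    (S : Finset (Fin n)) (s : ℝ) (hs : ∀ v ∈ S, f v j = s) (t : ℕ) :
    (badLevel G f j S s (t + 1)).card ≤
      (badLevel G f j S s t).card * (d - 1) + (jumpEdges G f j S (t + 1)).card := by
  have hpar : ∀ v, ∃ w, vertexSetDist G v S = ((t + 1 : ℕ) : ℕ∞) →
      G.Adj v w ∧ vertexSetDist G w S = (t : ℕ∞) := by
    intro v
    by_cases h : vertexSetDist G v S = ((t + 1 : ℕ) : ℕ∞)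
    · obtain ⟨w, hw⟩ := vsd_parent G S h
      exact ⟨w, fun _ => hw⟩
    · exact ⟨v, fun h' => absurd h' h⟩
  choose p hp using hpar
  set U := badLevel G f j S s (t + 1) with hU
  have hUm : ∀ v ∈ U, vertexSetDist G v S = ((t + 1 : ℕ) : ℕ∞) ∧ f v j ≠ s := by
    intro v hv; simpa [hU, badLevel] using hv
  rw [← Finset.card_filter_add_card_filter_not (s := U) (fun v => f (p v) j ≠ s)]
  refine Nat.add_le_add ?_ ?_
  · have hsub : U.filter (fun v => f (p v) j ≠ s) ⊆ (badLevel G f j S s t).biUnion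
        (fun w => (G.neighborFinset w).filter
          (fun v => vertexSetDist G v S = ((t + 1 : ℕ) : ℕ∞))) := by
      intro v hv
      rw [Finset.mem_filter] at hv
      obtain ⟨h1, h2⟩ := hUm v hv.1
      rw [Finset.mem_biUnion]
      refine ⟨p v, ?_, ?_⟩
      · simp only [badLevel, Finset.mem_filter, Finset.mem_univ, true_and]
        exact ⟨(hp v h1).2, hv.2⟩
      · rw [Finset.mem_filter, SimpleGraph.mem_neighborFinset]
        exact ⟨(hp v h1).1.symm, h1⟩
    refine (Finset.card_le_card hsub).trans (Finset.card_biUnion_le_card_mul _ _ _ ?_)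
    intro w hw
    simp only [badLevel, Finset.mem_filter, Finset.mem_univ, true_and] at hw
    obtain ⟨hw1, hw2⟩ := hw
    cases t with
    | zero => exact absurd (hs w (vsd_zero G S (by simpa using hw1))) hw2
    | succ t =>
      obtain ⟨x, hx, hxd⟩ := vsd_parent G S hw1
      have hlt : ((G.neighborFinset w).filter
          (fun v => vertexSetDist G v S = ((t + 1 + 1 : ℕ) : ℕ∞))).card
          < (G.neighborFinset w).card := by
        apply Finset.card_lt_card
        rw [Finset.filter_ssubset]
        refine ⟨x, by simpa using hx, ?_⟩
        rw [hxd]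
        intro h
        have : t = t + 1 + 1 := by exact_mod_cast h
        omega
      rw [SimpleGraph.card_neighborFinset_eq_degree, hreg] at hlt
      omega
  · apply Finset.card_le_card_of_injOn (fun v => s(p v, v))
    · intro v hv
      rw [Finset.mem_coe, Finset.mem_filter] at hv
      obtain ⟨h1, h2⟩ := hUm v hv.1
      obtain ⟨h3, h4⟩ := hp v h1
      have h5 := hv.2
      rw [not_not] at h5
      simp only [jumpEdges, Finset.coe_filter, Set.mem_setOf_eq, SimpleGraph.mem_edgeFinset,
        SimpleGraph.mem_edgeSet, Sym2.lift_mk]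
      refine ⟨h3.symm, ?_, ?_⟩
      · refine (esd_le G S _ _).trans ?_
        rw [h4]; simp
      · rw [h5]; exact h2.symm
    · intro v hv v' hv' he
      rw [Finset.mem_coe, Finset.mem_filter] at hv hv'
      obtain ⟨h1, h2⟩ := hUm v hv.1
      obtain ⟨h1', h2'⟩ := hUm v' hv'.1
      simp only [Sym2.eq_iff] at he
      rcases he with ⟨_, h⟩ | ⟨h, _⟩
      · exact h
      · have := (hp v h1).2
        rw [h, h1'] at this
        have : t + 1 = t := by exact_mod_cast this
        omega

/-- Lemma 3.4: existence of a scale `ℓ₀` with many jump edges around `S`. -/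
theorem stmt_8 {n d k : ℕ} (α ε L : ℝ) (hd : 3 ≤ d)
    (hα : 0 < α ∧ α ≤ 1) (hε : 0 < ε ∧ ε ≤ 1) (hL : 1 ≤ L)
    (G : SimpleGraph (Fin n)) [DecidableRel G.Adj]
    (hreg : ∀ v, G.degree v = d)
    (hExp : Expan n d G α ε L)
    (hk : 1 ≤ k) (f : Fin n → Fin k → ℝ)
    (hval : ∀ v j, f v j = -1 ∨ f v j = 0 ∨ f v j = 1)
    (hmed : ∀ j, (n : ℝ) / 2 ≤
      min ((univ.filter fun v => 0 ≤ f v j).card : ℝ)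
        ((univ.filter fun v => f v j ≤ 0).card : ℝ))
    (j : Fin k) (S : Finset (Fin n)) (hS : S.Nonempty)
    (hconst : ∀ v ∈ S, ∀ w ∈ S, f v j = f w j)
    (hnz : ∀ v ∈ S, f v j ≠ 0) :
    ∃ ℓ₀ : ℕ, 1 ≤ ℓ₀ ∧
      (∀ ℓ : ℕ, 1 ≤ ℓ → 3 * (n : ℝ) / 4 ≤ α * ((d : ℝ) - 1) ^ ℓ * S.card → ℓ₀ ≤ ℓ) ∧
      α * aseq ℓ₀ / 6 * ((d : ℝ) - 1) ^ (ℓ₀ - 1) * S.card ≤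
        ((jumpEdges G f j S ℓ₀).card : ℝ) := by
  have hn0 : 0 < n := by
    obtain ⟨v, _⟩ := hS
    exact Fin.pos v
  have hn : (0 : ℝ) < n := by exact_mod_cast hn0
  have hSc : (0 : ℝ) < S.card := by exact_mod_cast hS.card_pos
  obtain ⟨q, hq⟩ : ∃ q : ℝ, q = (d : ℝ) - 1 := ⟨_, rfl⟩
  have hd' : (3 : ℝ) ≤ d := by exact_mod_cast hd
  have hq2 : 2 ≤ q := by linarith
  rw [← hq]
  obtain ⟨v0, hv0⟩ := hS
  obtain ⟨s, hsdef⟩ : ∃ s, s = f v0 j := ⟨_, rfl⟩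
  have hs : ∀ v ∈ S, f v j = s := fun v hv => by rw [hsdef]; exact hconst v hv v0 hv0
  have hs0 : s ≠ 0 := by rw [hsdef]; exact hnz v0 hv0
  have hgood : ((univ.filter fun v => f v j = s).card : ℝ) ≤ n / 2 := by
    have hm := hmed j
    rw [le_min_iff] at hm
    rcases lt_or_gt_of_ne hs0 with h | h
    · have hdis : Disjoint (univ.filter fun v => f v j = s) (univ.filter fun v => 0 ≤ f v j) := by
        rw [Finset.disjoint_filter]; intro v _ h1 h2; linarith
      have hc := Finset.card_le_univ ((univ.filter fun v => f v j = s) ∪ (univ.filter fun v => 0 ≤ f v j))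
      rw [Finset.card_union_of_disjoint hdis, Fintype.card_fin] at hc
      have hc' : ((univ.filter fun v => f v j = s).card : ℝ) + ((univ.filter fun v => 0 ≤ f v j).card : ℝ) ≤ n := by
        exact_mod_cast hc
      linarith [hm.1]
    · have hdis : Disjoint (univ.filter fun v => f v j = s) (univ.filter fun v => f v j ≤ 0) := by
        rw [Finset.disjoint_filter]; intro v _ h1 h2; linarith
      have hc := Finset.card_le_univ ((univ.filter fun v => f v j = s) ∪ (univ.filter fun v => f v j ≤ 0))
      rw [Finset.card_union_of_disjoint hdis, Fintype.card_fin] at hc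
      have hc' : ((univ.filter fun v => f v j = s).card : ℝ) + ((univ.filter fun v => f v j ≤ 0).card : ℝ) ≤ n := by
        exact_mod_cast hc
      linarith [hm.2]
  have hSn : (S.card : ℝ) ≤ n / 2 := by
    refine le_trans ?_ hgood
    exact_mod_cast Finset.card_le_card (fun v hv => by simpa using hs v hv)
  have hex : ∃ ℓ : ℕ, 3 * (n : ℝ) / 4 ≤ α * q ^ (ℓ + 1) * S.card := by
    obtain ⟨m, hm⟩ := pow_unbounded_of_one_lt (3 * (n : ℝ) / 4 / (α * S.card)) (show 1 < q by linarith)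
    refine ⟨m, ?_⟩
    have hpos : 0 < α * S.card := mul_pos hα.1 hSc
    rw [div_lt_iff₀ hpos] at hm
    have : q ^ m ≤ q ^ (m + 1) := pow_le_pow_right₀ (by linarith) (by omega)
    nlinarith
  obtain ⟨m, hm, hmin⟩ : ∃ m : ℕ, 3 * (n : ℝ) / 4 ≤ α * q ^ (m + 1) * S.card ∧
      ∀ l < m, α * q ^ (l + 1) * S.card < 3 * (n : ℝ) / 4 :=
    ⟨Nat.find hex, Nat.find_spec hex, fun l hl => not_le.1 (Nat.find_min hex hl)⟩
  by_contra hcon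
  push Not at hcon
  have hJ : ∀ t ≤ m, ((jumpEdges G f j S (t + 1)).card : ℝ) <
      α * aseq (t + 1) / 6 * q ^ t * S.card := by
    intro t ht
    have := hcon (t + 1) (by omega) ?_
    · simpa using this
    · intro ℓ hℓ h
      by_contra hlt
      obtain ⟨l, rfl⟩ : ∃ l, ℓ = l + 1 := ⟨ℓ - 1, by omega⟩
      exact absurd h (not_le.2 (hmin l (by omega)))
  obtain ⟨c, hc⟩ : ∃ c : ℝ, c = α * S.card / 6 := ⟨_, rfl⟩
  have hc0 : 0 < c := by rw [hc]; have := hα.1; positivity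
  have hU0 : (badLevel G f j S s 0).card = 0 := by
    rw [Finset.card_eq_zero, badLevel, Finset.filter_eq_empty_iff]
    rintro v _ ⟨h1, h2⟩
    exact h2 (hs v (vsd_zero G S (by simpa using h1)))
  have hstep : ∀ t, ((badLevel G f j S s (t + 1)).card : ℝ) ≤
      (badLevel G f j S s t).card * q + (jumpEdges G f j S (t + 1)).card := by
    intro t
    have := bad_step G hreg f j S s hs t
    have h2 : ((d - 1 : ℕ) : ℝ) = q := by rw [hq, Nat.cast_sub (by omega)]; simp
    rw [← h2]
    exact_mod_cast this
  have hU : ∀ t ≤ m, ((badLevel G f j S s (t + 1)).card : ℝ) ≤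
      c * q ^ t * ∑ i ∈ Finset.range (t + 1), aseq (i + 1) := by
    intro t
    induction t with
    | zero =>
      intro h
      have h1 := hstep 0
      have h2 := hJ 0 h
      rw [hU0] at h1
      have h1' : ((badLevel G f j S s 1).card : ℝ) ≤ ((jumpEdges G f j S 1).card : ℝ) := by
        simpa using h1
      simp at h2 ⊢
      rw [hc]
      linarith
    | succ t ih =>
      intro h
      have h1 := hstep (t + 1)
      have h2 := hJ (t + 1) h
      have h3 := mul_le_mul_of_nonneg_right (ih (by omega)) (show 0 ≤ q by linarith)
      rw [Finset.sum_range_succ]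
      have h4 : α * aseq (t + 1 + 1) / 6 * q ^ (t + 1) * S.card = c * q ^ (t + 1) * aseq (t + 1 + 1) := by
        rw [hc]; ring
      have h5 : c * q ^ t * (∑ i ∈ Finset.range (t + 1), aseq (i + 1)) * q =
        c * q ^ (t + 1) * (∑ i ∈ Finset.range (t + 1), aseq (i + 1)) := by ring
      rw [mul_add]
      linarith
  have hU' : ∀ t ≤ m, ((badLevel G f j S s (t + 1)).card : ℝ) ≤ c * q ^ t := by
    intro t ht
    refine (hU t ht).trans (mul_le_of_le_one_right (by positivity) (aseq_sum_le _))
  have hsum : ∀ r ≤ m, ∑ t ∈ Finset.range (r + 1), ((badLevel G f j S s (t + 1)).card : ℝ) ≤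
      2 * c * q ^ r := by
    intro r
    induction r with
    | zero =>
      intro h
      have := hU' 0 h
      simp at this ⊢
      linarith
    | succ r ih =>
      intro h
      rw [Finset.sum_range_succ]
      have h1 := ih (by omega)
      have h2 := hU' (r + 1) h
      have h3 : 0 ≤ c * q ^ r * (q - 2) := mul_nonneg (by positivity) (by linarith)
      have h4 : c * q ^ (r + 1) = c * q ^ r * (q - 2) + 2 * c * q ^ r := by ring
      have h5 : 2 * c * q ^ (r + 1) = c * q ^ (r + 1) + c * q ^ (r + 1) := by ring
      linarith
  have hball := hExp.1 S ⟨v0, hv0⟩ (m + 1) (by omega)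
  rw [← hq, min_eq_left hm] at hball
  have hcover : (univ.filter fun v => vertexSetDist G v S ≤ ((m + 1 : ℕ) : ℕ∞)) ⊆
      (univ.filter fun v => f v j = s) ∪
        (Finset.range (m + 1)).biUnion (fun t => badLevel G f j S s (t + 1)) := by
    intro v hv
    simp only [Finset.mem_filter, Finset.mem_univ, true_and] at hv
    rw [Finset.mem_union, Finset.mem_biUnion]
    by_cases hf : f v j = s
    · left; simpa using hf
    right
    obtain ⟨t, ht⟩ := ENat.ne_top_iff_exists.1 (ne_top_of_le_ne_top (ENat.coe_ne_top _) hv)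
    rw [← ht] at hv
    have htm : t ≤ m + 1 := by exact_mod_cast hv
    cases t with
    | zero => exact absurd (hs v (vsd_zero G S (by simpa using ht.symm))) hf
    | succ t =>
      exact ⟨t, by simp; omega, by simp only [badLevel, Finset.mem_filter, Finset.mem_univ, true_and]; exact ⟨ht.symm, hf⟩⟩
  have hcard := (Finset.card_le_card hcover).trans ((Finset.card_union_le _ _).trans
    (Nat.add_le_add_left Finset.card_biUnion_le _))
  have hcard' : ((univ.filter fun v => vertexSetDist G v S ≤ ((m + 1 : ℕ) : ℕ∞)).card : ℝ) ≤
      ((univ.filter fun v => f v j = s).card : ℝ) +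
        ∑ t ∈ Finset.range (m + 1), ((badLevel G f j S s (t + 1)).card : ℝ) := by
    exact_mod_cast hcard
  have h1 := hsum m le_rfl
  have h2 : 2 * c * q ^ m = α * q ^ m * S.card / 3 := by rw [hc]; ring
  have h3 : α * q ^ m * S.card < 3 * (n : ℝ) / 4 := by
    cases m with
    | zero =>
      have := hα.2
      simp
      nlinarith
    | succ l => exact hmin l (by omega)
  linarith
end

section
/- Let d ≥ 3 be an integer, let α, ε ∈ (0,1], L ≥ 1, and let G be a d-regular simple graph on [n] satisfying the long-range expansion property Expan(α,ε,L). Let k ≥ 1 and let f : [n] → {−1,0,1}^k satisfy min{|{v ∈ [n] : f(v)_j ≥ 0}|, |{v ∈ [n] : f(v)_j ≤ 0}|} ≥ n/2 for every j ∈ [k]. Then: (1) for every v ∈ [n] and j ∈ [k] with f(v)_j ≠ 0, the set {ℓ ≥ 1 : |E(v,j;ℓ)| ≥ (α·a_ℓ/6)(d−1)^{ℓ−1}} is nonempty, and its minimum ℓ_{v,j} satisfies α(d−1)^{ℓ_{v,j}−1} ≤ 3n/4; and (2) for every j ∈ [k] and every integer ℓ ≥ 1, α(d−1)^{ℓ−1}·|V_+(j;ℓ)|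 ≤ 3n/4 and α(d−1)^{ℓ−1}·|V_−(j;ℓ)| ≤ 3n/4. -/
open Finset

attribute [local instance] Classical.propDecidable

theorem aux_parent {n : ℕ} (G : SimpleGraph (Fin n)) (v u : Fin n) (m : ℕ)
    (h : G.edist v u = ((m + 1 : ℕ) : ℕ∞)) : ∃ p, G.edist v p = (m : ℕ∞) ∧ G.Adj p u := by
  rw [SimpleGraph.edist_comm] at h
  obtain ⟨w, hw⟩ := SimpleGraph.exists_walk_of_edist_eq_coe h
  cases w with
  | nil => simp at hw
  | @cons _ p _ hadj w' =>
    simp at hw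
    refine ⟨p, ?_, hadj.symm⟩
    have h1 : G.edist p v ≤ (m : ℕ∞) := by
      rw [← hw]; exact SimpleGraph.edist_le w'
    have h2 : G.edist u v ≤ G.edist u p + G.edist p v := SimpleGraph.edist_triangle
    rw [SimpleGraph.edist_eq_one_iff_adj.mpr hadj, h] at h2
    rw [SimpleGraph.edist_comm]
    apply le_antisymm h1
    push_cast at h2
    rw [add_comm] at h2
    exact (ENat.add_le_add_iff_left (by simp)).mp h2

theorem aux_step {n d k : ℕ} (hd : 3 ≤ d) (G : SimpleGraph (Fin n)) [DecidableRel G.Adj]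
    (hreg : ∀ v, G.degree v = d) (f : Fin n → Fin k → ℝ) (v : Fin n) (j : Fin k) (m : ℕ) :
    (univ.filter fun u => G.edist v u = ((m + 1 : ℕ) : ℕ∞) ∧ f u j ≠ f v j).card ≤
      (univ.filter fun u => G.edist v u = (m : ℕ∞) ∧ f u j ≠ f v j).card * (d - 1) +
        (jumpEdges G f j {v} (m + 1)).card := by
  set Y := univ.filter fun u => G.edist v u = (m : ℕ∞) ∧ f u j ≠ f v j with hY
  set Z := univ.filter fun u => (G.edist v u = ((m + 1 : ℕ) : ℕ∞) ∧ f u j ≠ f v j) ∧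
    ∃ p, (G.edist v p = (m : ℕ∞) ∧ G.Adj p u) ∧ f p j = f v j with hZ
  let C : Fin n → Finset (Fin n) := fun p =>
    univ.filter fun u => G.Adj p u ∧ G.edist v u = ((m + 1 : ℕ) : ℕ∞)
  have hsub : (univ.filter fun u => G.edist v u = ((m + 1 : ℕ) : ℕ∞) ∧ f u j ≠ f v j) ⊆
      Y.biUnion C ∪ Z := by
    intro u hu
    simp only [mem_filter, mem_univ, true_and] at hu
    obtain ⟨p, hp, hadj⟩ := aux_parent G v u m hu.1
    rw [mem_union]
    by_cases hf : f p j = f v j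
    · right
      simp only [hZ, mem_filter, mem_univ, true_and]
      exact ⟨hu, p, ⟨hp, hadj⟩, hf⟩
    · left
      rw [mem_biUnion]
      refine ⟨p, ?_, ?_⟩
      · simp only [hY, mem_filter, mem_univ, true_and]; exact ⟨hp, hf⟩
      · simp only [C, mem_filter, mem_univ, true_and]; exact ⟨hadj, hu.1⟩
  have hC : ∀ p ∈ Y, (C p).card ≤ d - 1 := by
    intro p hp
    simp only [hY, mem_filter, mem_univ, true_and] at hp
    obtain ⟨hp1, hp2⟩ := hp
    cases m with
    | zero =>
      have : v = p := (SimpleGraph.edist_eq_zero_iff (G := G)).mp (by simpa using hp1)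
      exact absurd (by rw [this]) hp2
    | succ m =>
      obtain ⟨r, hr, hadj⟩ := aux_parent G v p m hp1
      have hs : C p ⊆ (G.neighborFinset p).erase r := by
        intro u hu
        simp only [C, mem_filter, mem_univ, true_and] at hu
        rw [mem_erase, SimpleGraph.mem_neighborFinset]
        refine ⟨?_, hu.1⟩
        rintro rfl
        have := hu.2
        rw [hr] at this
        have := Nat.cast_injective (R := ℕ∞) this
        omega
      have := card_le_card hs
      rw [card_erase_of_mem (by rw [SimpleGraph.mem_neighborFinset]; exact hadj.symm),
        SimpleGraph.card_neighborFinset_eq_degree, hreg] at this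
      exact this
  have hZc : Z.card ≤ (jumpEdges G f j {v} (m + 1)).card := by
    have hex : ∀ u : Fin n, ∃ p, u ∈ Z → ((G.edist v p = (m : ℕ∞) ∧ G.Adj p u) ∧ f p j = f v j) := by
      intro u
      by_cases hu : u ∈ Z
      · have hu' := hu
        simp only [hZ, mem_filter, mem_univ, true_and] at hu'
        obtain ⟨p, hp⟩ := hu'.2
        exact ⟨p, fun _ => hp⟩
      · exact ⟨u, fun h => absurd h hu⟩
    choose g hg using hex
    have hZ1 : ∀ u ∈ Z, G.edist v u = ((m + 1 : ℕ) : ℕ∞) ∧ f u j ≠ f v j := by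
      intro u hu
      simp only [hZ, mem_filter, mem_univ, true_and] at hu
      exact hu.1
    apply card_le_card_of_injOn (fun u => s(g u, u))
    · intro u hu
      have hu : u ∈ Z := hu
      obtain ⟨⟨h1, h2⟩, h3⟩ := hg u hu
      obtain ⟨h4, h5⟩ := hZ1 u hu
      simp only [jumpEdges, mem_coe, mem_filter, SimpleGraph.mem_edgeFinset,
        SimpleGraph.mem_edgeSet, edgeSetDist, edgeDist, inf_singleton, Sym2.lift_mk]
      refine ⟨h2, ?_, ?_⟩
      · simp [h1]
      · rw [h3]; exact h5.symm
    · intro u hu u' hu' heq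
      have hu : u ∈ Z := hu
      have hu' : u' ∈ Z := hu'
      simp only [Sym2.eq_iff] at heq
      rcases heq with h | h
      · exact h.2
      · exfalso
        have h1 := (hg u' hu').1.1
        have h2 := (hZ1 u hu).1
        rw [h.2, h1] at h2
        have := Nat.cast_injective (R := ℕ∞) h2
        omega
  calc _ ≤ (Y.biUnion C ∪ Z).card := card_le_card hsub
    _ ≤ (Y.biUnion C).card + Z.card := card_union_le _ _
    _ ≤ _ := add_le_add (card_biUnion_le_card_mul _ _ _ hC) hZc

theorem aux_aseq_sum (m : ℕ) : ∑ i ∈ range m, aseq (i + 1) ≤ 1 := by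
  have h := hasSum_zeta_two
  have h2 := h.mul_left (6 / Real.pi ^ 2)
  have hpi := Real.pi_pos
  have e : 6 / Real.pi ^ 2 * (Real.pi ^ 2 / 6) = 1 := by field_simp
  rw [e] at h2
  have h3 : ∑ i ∈ range (m + 1), aseq i ≤ 1 := by
    apply sum_le_hasSum _ _ h2
    intro i _; positivity
  rw [sum_range_succ'] at h3
  have : aseq 0 = 0 := by simp [aseq]
  linarith

theorem aux_Y {n d k : ℕ} (α : ℝ) (hd : 3 ≤ d) (G : SimpleGraph (Fin n)) [DecidableRel G.Adj]
    (hreg : ∀ v, G.degree v = d) (f : Fin n → Fin k → ℝ) (v : Fin n) (j : Fin k) (m : ℕ)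
    (hE : ∀ i, i < m → ((jumpEdges G f j {v} (i + 1)).card : ℝ) ≤
      α * aseq (i + 1) / 6 * ((d : ℝ) - 1) ^ i) :
    ((univ.filter fun u => G.edist v u = (m : ℕ∞) ∧ f u j ≠ f v j).card : ℝ) * ((d : ℝ) - 1) ≤
      α / 6 * ((d : ℝ) - 1) ^ m * ∑ i ∈ range m, aseq (i + 1) := by
  have hq : (2 : ℝ) ≤ (d : ℝ) - 1 := by
    have : (3 : ℝ) ≤ d := by exact_mod_cast hd
    linarith
  induction m with
  | zero =>
    have : (univ.filter fun u => G.edist v u = ((0 : ℕ) : ℕ∞) ∧ f u j ≠ f v j) = ∅ := by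
      apply filter_eq_empty_iff.mpr
      rintro u - ⟨h1, h2⟩
      have : v = u := (SimpleGraph.edist_eq_zero_iff (G := G)).mp (by simpa using h1)
      exact h2 (by rw [this])
    rw [this]; simp
  | succ m ih =>
    have ih := ih (fun i hi => hE i (by omega))
    have hs : ((univ.filter fun u => G.edist v u = ((m + 1 : ℕ) : ℕ∞) ∧ f u j ≠ f v j).card : ℝ) ≤
      ((univ.filter fun u => G.edist v u = (m : ℕ∞) ∧ f u j ≠ f v j).card : ℝ) * ((d : ℝ) - 1) +
        ((jumpEdges G f j {v} (m + 1)).card : ℝ) := by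
      have := aux_step hd G hreg f v j m
      have h2 : ((d - 1 : ℕ) : ℝ) = (d : ℝ) - 1 := by
        rw [Nat.cast_sub (by omega)]; simp
      rw [← h2]
      exact_mod_cast this
    have h3 := hE m (by omega)
    rw [sum_range_succ, pow_succ]
    have := mul_le_mul_of_nonneg_right (hs.trans (add_le_add ih h3))
      (by linarith : (0 : ℝ) ≤ (d : ℝ) - 1)
    linarith

theorem aux_X {n d k : ℕ} (α : ℝ) (hα : 0 < α) (hd : 3 ≤ d) (G : SimpleGraph (Fin n))
    [DecidableRel G.Adj]
    (hreg : ∀ v, G.degree v = d) (f : Fin n → Fin k → ℝ) (v : Fin n) (j : Fin k) (m : ℕ)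
    (hE : ∀ i, i < m + 1 → ((jumpEdges G f j {v} (i + 1)).card : ℝ) ≤
      α * aseq (i + 1) / 6 * ((d : ℝ) - 1) ^ i) :
    ((univ.filter fun u => G.edist v u ≤ ((m + 1 : ℕ) : ℕ∞) ∧ f u j ≠ f v j).card : ℝ) ≤
      α / 6 * (2 * ((d : ℝ) - 1) ^ m - 1) := by
  have hq : (2 : ℝ) ≤ (d : ℝ) - 1 := by
    have : (3 : ℝ) ≤ d := by exact_mod_cast hd
    linarith
  have hY : ∀ t, t ≤ m →
      ((univ.filter fun u => G.edist v u = ((t + 1 : ℕ) : ℕ∞) ∧ f u j ≠ f v j).card : ℝ) ≤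
        α / 6 * ((d : ℝ) - 1) ^ t := by
    intro t ht
    have h := aux_Y α hd G hreg f v j (t + 1) (fun i hi => hE i (by omega))
    have h1 := aux_aseq_sum (t + 1)
    have h2 : (0 : ℝ) ≤ α / 6 * ((d : ℝ) - 1) ^ (t + 1) := by
      have : (0 : ℝ) ≤ (d : ℝ) - 1 := by linarith
      positivity
    have h3 := h.trans (mul_le_mul_of_nonneg_left h1 h2)
    rw [pow_succ, mul_one, ← mul_assoc] at h3
    exact le_of_mul_le_mul_right h3 (by linarith)
  clear hE
  have hX : ∀ t, (univ.filter fun u => G.edist v u ≤ ((t + 1 : ℕ) : ℕ∞) ∧ f u j ≠ f v j).card ≤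
      (univ.filter fun u => G.edist v u ≤ (t : ℕ∞) ∧ f u j ≠ f v j).card +
      (univ.filter fun u => G.edist v u = ((t + 1 : ℕ) : ℕ∞) ∧ f u j ≠ f v j).card := by
    intro t
    refine le_trans (card_le_card ?_) (card_union_le _ _)
    intro u hu
    simp only [mem_union, mem_filter, mem_univ, true_and] at hu ⊢
    rcases hu.1.lt_or_eq with h | h
    · left
      refine ⟨?_, hu.2⟩
      push_cast at h
      exact Order.le_of_lt_add_one h
    · right; exact ⟨h, hu.2⟩
  induction m with
  | zero =>
    have h0 : (univ.filter fun u => G.edist v u ≤ ((0 : ℕ) : ℕ∞) ∧ f u j ≠ f v j) = ∅ := by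
      apply filter_eq_empty_iff.mpr
      rintro u - ⟨h1, h2⟩
      have : v = u := (SimpleGraph.edist_eq_zero_iff (G := G)).mp (by simpa using h1)
      exact h2 (by rw [this])
    have h1 := hX 0
    have h2 := hY 0 le_rfl
    have h1' : ((univ.filter fun u => G.edist v u ≤ ((0 + 1 : ℕ) : ℕ∞) ∧ f u j ≠ f v j).card : ℝ) ≤
      ((univ.filter fun u => G.edist v u = ((0 + 1 : ℕ) : ℕ∞) ∧ f u j ≠ f v j).card : ℝ) := by
      exact Nat.cast_le.mpr (by simpa only [h0, card_empty, Nat.zero_add] using h1)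
    refine (h1'.trans h2).trans ?_
    norm_num
  | succ m ih =>
    have ih := ih (fun t ht => hY t (by omega))
    have h1 := hX (m + 1)
    have h2 := hY (m + 1) le_rfl
    have h1' : ((univ.filter fun u => G.edist v u ≤ ((m + 1 + 1 : ℕ) : ℕ∞) ∧ f u j ≠ f v j).card : ℝ) ≤
      ((univ.filter fun u => G.edist v u ≤ ((m + 1 : ℕ) : ℕ∞) ∧ f u j ≠ f v j).card : ℝ) +
      ((univ.filter fun u => G.edist v u = ((m + 1 + 1 : ℕ) : ℕ∞) ∧ f u j ≠ f v j).card : ℝ) := by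
      exact_mod_cast h1
    have hp : (0 : ℝ) < ((d : ℝ) - 1) ^ m := pow_pos (by linarith) _
    have h3 : 2 * ((d : ℝ) - 1) ^ m ≤ ((d : ℝ) - 1) ^ (m + 1) := by
      rw [pow_succ, mul_comm]; exact mul_le_mul_of_nonneg_left hq hp.le
    have h4 := mul_le_mul_of_nonneg_left h3 (by positivity : (0 : ℝ) ≤ α / 6)
    linarith

theorem aux_main {n d k : ℕ} (α : ℝ) (hd : 3 ≤ d) (hα : 0 < α)
    (G : SimpleGraph (Fin n)) [DecidableRel G.Adj]
    (hreg : ∀ v, G.degree v = d) (hA : ExpanA n d G α) (f : Fin n → Fin k → ℝ) (j : Fin k)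
    (c : ℝ) (hc : (n : ℝ) / 2 ≤ ((univ.filter fun v => f v j ≠ c).card : ℝ))
    (S : Finset (Fin n)) (hS : S.Nonempty) (hSc : ∀ v ∈ S, f v j = c) (m : ℕ)
    (h1 : 3 * (n : ℝ) / 4 ≤ α * ((d : ℝ) - 1) ^ (m + 1) * S.card)
    (h2 : α * ((d : ℝ) - 1) ^ m * S.card ≤ 3 * (n : ℝ) / 4)
    (hE : ∀ v ∈ S, ∀ i, i < m + 1 → ((jumpEdges G f j {v} (i + 1)).card : ℝ) ≤
      α * aseq (i + 1) / 6 * ((d : ℝ) - 1) ^ i) : False := by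
  have hB := hA S hS (m + 1) (by omega)
  rw [min_eq_left h1] at hB
  set B := univ.filter fun v => vertexSetDist G v S ≤ ((m + 1 : ℕ) : ℕ∞) with hBdef
  set D := univ.filter fun v => f v j ≠ c with hD
  have hBD : (B.card : ℝ) + D.card ≤ n + (B ∩ D).card := by
    have e := card_union_add_card_inter B D
    have e2 : (B ∪ D).card ≤ n := by simpa using card_le_univ (B ∪ D)
    have : B.card + D.card ≤ n + (B ∩ D).card := by omega
    exact_mod_cast this
  have hsub : B ∩ D ⊆ S.biUnion fun v =>
      univ.filter fun u => G.edist v u ≤ ((m + 1 : ℕ) : ℕ∞) ∧ f u j ≠ f v j := by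
    intro u hu
    have hu1 : vertexSetDist G u S ≤ ((m + 1 : ℕ) : ℕ∞) :=
      (mem_filter.mp (mem_inter.mp hu).1).2
    have hu2 : f u j ≠ c := (mem_filter.mp (mem_inter.mp hu).2).2
    unfold vertexSetDist at hu1
    obtain ⟨w, hw, hwe⟩ := exists_mem_eq_inf S hS (fun w => G.edist u w)
    rw [mem_biUnion]
    refine ⟨w, hw, ?_⟩
    simp only [mem_filter, mem_univ, true_and]
    refine ⟨?_, ?_⟩
    · rw [SimpleGraph.edist_comm, ← hwe]; exact hu1
    · rw [hSc w hw]; exact hu2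
  have hcard : ((B ∩ D).card : ℝ) ≤ S.card * (α / 6 * (2 * ((d : ℝ) - 1) ^ m - 1)) := by
    have h := (card_le_card hsub).trans card_biUnion_le
    have h' : ((B ∩ D).card : ℝ) ≤ ∑ v ∈ S, ((univ.filter fun u =>
        G.edist v u ≤ ((m + 1 : ℕ) : ℕ∞) ∧ f u j ≠ f v j).card : ℝ) := by exact_mod_cast h
    refine h'.trans ?_
    rw [← nsmul_eq_mul]
    exact sum_le_card_nsmul _ _ _ (fun v hv => aux_X α hα hd G hreg f v j m (hE v hv))
  have hpos : (0 : ℝ) < S.card * α := by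
    have : (0 : ℝ) < S.card := by exact_mod_cast hS.card_pos
    positivity
  linarith

theorem aux_part1 {n d k : ℕ} (α : ℝ) (hd : 3 ≤ d) (hα : 0 < α) (hα1 : α ≤ 1)
    (G : SimpleGraph (Fin n)) [DecidableRel G.Adj]
    (hreg : ∀ v, G.degree v = d) (hA : ExpanA n d G α) (f : Fin n → Fin k → ℝ) (j : Fin k)
    (v : Fin n) (hc : (n : ℝ) / 2 ≤ ((univ.filter fun u => f u j ≠ f v j).card : ℝ)) :
      {ℓ : ℕ | 1 ≤ ℓ ∧
          α * aseq ℓ / 6 * ((d : ℝ) - 1) ^ (ℓ - 1) ≤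
            ((jumpEdges G f j {v} ℓ).card : ℝ)}.Nonempty ∧
        α * ((d : ℝ) - 1) ^ (lvj G f α d v j - 1) ≤ 3 * (n : ℝ) / 4 := by
  have hq : (2 : ℝ) ≤ (d : ℝ) - 1 := by
    have : (3 : ℝ) ≤ d := by exact_mod_cast hd
    linarith
  have hn : (4 : ℝ) ≤ n := by
    have := G.degree_lt_card_verts v
    rw [hreg, Fintype.card_fin] at this
    have : 4 ≤ n := by omega
    exact_mod_cast this
  have hex : ∃ m : ℕ, 3 * (n : ℝ) / 4 < α * ((d : ℝ) - 1) ^ (m + 1) := by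
    obtain ⟨m, hm⟩ := pow_unbounded_of_one_lt (3 * (n : ℝ) / 4 / α)
      (by linarith : (1 : ℝ) < (d : ℝ) - 1)
    refine ⟨m, ?_⟩
    rw [div_lt_iff₀ hα] at hm
    have : ((d : ℝ) - 1) ^ m ≤ ((d : ℝ) - 1) ^ (m + 1) :=
      pow_le_pow_right₀ (by linarith) (by omega)
    nlinarith
  have h1 := Nat.find_spec hex
  have hmin := fun i => @Nat.find_min _ _ hex i
  set m := Nat.find hex with hm
  have h2 : α * ((d : ℝ) - 1) ^ m ≤ 3 * (n : ℝ) / 4 := by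
    rcases Nat.eq_zero_or_pos m with h | h
    · rw [h]; simp; linarith
    · have := hmin (m - 1) (by omega)
      rw [Nat.sub_add_cancel h] at this
      exact not_lt.mp this
  have key : ∃ i, i < m + 1 ∧ α * aseq (i + 1) / 6 * ((d : ℝ) - 1) ^ i ≤
      ((jumpEdges G f j {v} (i + 1)).card : ℝ) := by
    by_contra! hcon
    refine aux_main α hd hα G hreg hA f j (f v j) hc {v} (by simp) (by simp) m ?_ ?_ ?_
    · simpa using h1.le
    · simpa using h2
    · intro w hw i hi
      rw [mem_singleton] at hw
      subst hw
      exact (hcon i hi).le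
  obtain ⟨i, hi, hE⟩ := key
  have hmem : i + 1 ∈ {ℓ : ℕ | 1 ≤ ℓ ∧
          α * aseq ℓ / 6 * ((d : ℝ) - 1) ^ (ℓ - 1) ≤
            ((jumpEdges G f j {v} ℓ).card : ℝ)} := ⟨by omega, by simpa using hE⟩
  refine ⟨⟨_, hmem⟩, ?_⟩
  have hle : lvj G f α d v j ≤ i + 1 := Nat.sInf_le hmem
  refine le_trans (mul_le_mul_of_nonneg_left ?_ hα.le) h2
  exact pow_le_pow_right₀ (by linarith) (by omega)

theorem aux_part2 {n d k : ℕ} (α : ℝ) (hd : 3 ≤ d) (hα : 0 < α) (hα1 : α ≤ 1)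
    (G : SimpleGraph (Fin n)) [DecidableRel G.Adj]
    (hreg : ∀ v, G.degree v = d) (hA : ExpanA n d G α) (f : Fin n → Fin k → ℝ) (j : Fin k)
    (c : ℝ) (hc : (n : ℝ) / 2 ≤ ((univ.filter fun u => f u j ≠ c).card : ℝ)) (ℓ : ℕ) (hℓ : 1 ≤ ℓ)
    (V : Finset (Fin n)) (hV : ∀ v ∈ V, f v j = c ∧ lvj G f α d v j = ℓ) :
    α * ((d : ℝ) - 1) ^ (ℓ - 1) * (V.card : ℝ) ≤ 3 * (n : ℝ) / 4 := by
  have hq : (2 : ℝ) ≤ (d : ℝ) - 1 := by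
    have : (3 : ℝ) ≤ d := by exact_mod_cast hd
    linarith
  rcases Nat.lt_or_ge 1 ℓ with hl | hl
  swap
  · obtain rfl : ℓ = 1 := by omega
    have hdis : Disjoint V (univ.filter fun u => f u j ≠ c) := by
      rw [disjoint_left]
      intro u hu hu'
      simp only [mem_filter, mem_univ, true_and] at hu'
      exact hu' (hV u hu).1
    have e : V.card + (univ.filter fun u => f u j ≠ c).card ≤ n := by
      rw [← card_union_of_disjoint hdis]
      simpa using card_le_univ (V ∪ univ.filter fun u => f u j ≠ c)
    have e' : (V.card : ℝ) + ((univ.filter fun u => f u j ≠ c).card : ℝ) ≤ n := by exact_mod_cast e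
    have h0 : (0 : ℝ) ≤ V.card := by positivity
    have : α * V.card ≤ 1 * V.card := mul_le_mul_of_nonneg_right hα1 h0
    have hn : (0 : ℝ) ≤ n := by positivity
    simp only [Nat.sub_self, pow_zero, mul_one]
    linarith
  obtain ⟨m, rfl⟩ : ∃ m, ℓ = m + 2 := ⟨ℓ - 2, by omega⟩
  simp only [Nat.add_sub_cancel, show m + 2 - 1 = m + 1 by omega]
  have hP : (0 : ℝ) < α * ((d : ℝ) - 1) ^ m := by
    have : (0 : ℝ) < ((d : ℝ) - 1) ^ m := pow_pos (by linarith) _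
    positivity
  have hPP : 2 * (α * ((d : ℝ) - 1) ^ m) ≤ α * ((d : ℝ) - 1) ^ (m + 1) := by
    rw [pow_succ]
    have := mul_le_mul_of_nonneg_left hq hP.le
    linarith
  -- induct on the set
  suffices H : ∀ S : Finset (Fin n), S ⊆ V →
      α * ((d : ℝ) - 1) ^ (m + 1) * (S.card : ℝ) ≤ 3 * (n : ℝ) / 4 from H V subset_rfl
  intro S
  induction S using Finset.induction_on with
  | empty => intro _; simp; positivity
  | insert a T haT ih =>
    intro hsub
    have ih := ih (fun x hx => hsub (mem_insert_of_mem hx))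
    by_contra! hcon
    have hcard : ((insert a T).card : ℝ) = T.card + 1 := by
      rw [card_insert_of_notMem haT]; simp
    have ha := hV a (hsub (mem_insert_self _ _))
    have hp1 := (aux_part1 α hd hα hα1 G hreg hA f j a (by rw [ha.1]; exact hc)).2
    rw [ha.2, show m + 2 - 1 = m + 1 by omega] at hp1
    have hT : (1 : ℝ) ≤ T.card := by
      rcases T.eq_empty_or_nonempty with h | h
      · exfalso
        rw [hcard, h] at hcon
        simp at hcon
        linarith
      · exact_mod_cast h.card_pos
    refine aux_main α hd hα G hreg hA f j c hc (insert a T) (insert_nonempty _ _)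
      (fun v hv => (hV v (hsub hv)).1) m hcon.le ?_ ?_
    · rw [hcard]
      refine le_trans ?_ ih
      have := mul_le_mul_of_nonneg_right hPP (by linarith : (0 : ℝ) ≤ T.card)
      have := mul_le_mul_of_nonneg_left hT hP.le
      linarith
    · intro v hv i hi
      by_contra! hlt
      have hle : lvj G f α d v j ≤ i + 1 :=
        Nat.sInf_le ⟨by omega, by simpa using hlt.le⟩
      rw [(hV v (hsub hv)).2] at hle
      omega

/-- Corollary 3.5: the scales `ℓ_{v,j}` are well defined, and estimates for
`ℓ_{v,j}`, `|V_+(j;ℓ)|` and `|V_-(j;ℓ)|`. -/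
theorem stmt_9 {n d k : ℕ} (α ε L : ℝ) (hd : 3 ≤ d)
    (hα : 0 < α ∧ α ≤ 1) (hε : 0 < ε ∧ ε ≤ 1) (hL : 1 ≤ L)
    (G : SimpleGraph (Fin n)) [DecidableRel G.Adj]
    (hreg : ∀ v, G.degree v = d)
    (hExp : Expan n d G α ε L)
    (hk : 1 ≤ k) (f : Fin n → Fin k → ℝ)
    (hval : ∀ v j, f v j = -1 ∨ f v j = 0 ∨ f v j = 1)
    (hmed : ∀ j, (n : ℝ) / 2 ≤
      min ((univ.filter fun v => 0 ≤ f v j).card : ℝ)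
        ((univ.filter fun v => f v j ≤ 0).card : ℝ)) :
    (∀ (v : Fin n) (j : Fin k), f v j ≠ 0 →
      {ℓ : ℕ | 1 ≤ ℓ ∧
          α * aseq ℓ / 6 * ((d : ℝ) - 1) ^ (ℓ - 1) ≤
            ((jumpEdges G f j {v} ℓ).card : ℝ)}.Nonempty ∧
        α * ((d : ℝ) - 1) ^ (lvj G f α d v j - 1) ≤ 3 * (n : ℝ) / 4) ∧
    ∀ (j : Fin k) (ℓ : ℕ), 1 ≤ ℓ →
      α * ((d : ℝ) - 1) ^ (ℓ - 1) * ((Vplus G f α d j ℓ).card : ℝ) ≤ 3 * (n : ℝ) / 4 ∧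
      α * ((d : ℝ) - 1) ^ (ℓ - 1) * ((Vminus G f α d j ℓ).card : ℝ) ≤ 3 * (n : ℝ) / 4 := by
  have hp : ∀ j, (n : ℝ) / 2 ≤ ((univ.filter fun u => f u j ≠ 1).card : ℝ) := by
    intro j
    refine ((hmed j).trans (min_le_right _ _)).trans ?_
    have : (univ.filter fun v => f v j ≤ 0) ⊆ (univ.filter fun u => f u j ≠ 1) := by
      intro u hu
      simp only [mem_filter, mem_univ, true_and] at hu ⊢
      intro h; rw [h] at hu; linarith
    exact_mod_cast card_le_card this
  have hm : ∀ j, (n : ℝ) / 2 ≤ ((univ.filter fun u => f u j ≠ -1).card : ℝ) := by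
    intro j
    refine ((hmed j).trans (min_le_left _ _)).trans ?_
    have : (univ.filter fun v => 0 ≤ f v j) ⊆ (univ.filter fun u => f u j ≠ -1) := by
      intro u hu
      simp only [mem_filter, mem_univ, true_and] at hu ⊢
      intro h; rw [h] at hu; linarith
    exact_mod_cast card_le_card this
  refine ⟨?_, ?_⟩
  · intro v j hv
    apply aux_part1 α hd hα.1 hα.2 G hreg hExp.1 f j v
    rcases hval v j with h | h | h
    · rw [h]; exact hm j
    · exact absurd h hv
    · rw [h]; exact hp j
  · intro j ℓ hℓ
    refine ⟨aux_part2 α hd hα.1 hα.2 G hreg hExp.1 f j 1 (hp j) ℓ hℓ _ ?_,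
      aux_part2 α hd hα.1 hα.2 G hreg hExp.1 f j (-1) (hm j) ℓ hℓ _ ?_⟩
    · intro v hv
      simpa only [Vplus, mem_filter, mem_univ, true_and] using hv
    · intro v hv
      simpa only [Vminus, mem_filter, mem_univ, true_and] using hv
end
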